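/- arXiv:math/0608680 — 4 statements merged into one kernel-verified Lean document; each statement's English description precedes it below -/
import Mathlib

section
/- Let K and L be simple augmented directed complexes, and let f be a function assigning to each n-dimensional basis element of K (for every n) a separated sequence of n-dimensional basis elements of L. Then f extends to a morphism of augmented directed complexes K → L if and only if the following two conditions hold. (i) If a_1 < … < a_p are the 0-dimensional basis elements of K, then each f a_i is a singleton sequence and f a_1 ≤ … ≤ f a_p. (ii) For each n > 0, if a' < a'' are (n−1)-dimensional basis elements of K such that every basis element strictly between a' and a'' has dimension ≥ n, and a_1 < … < a_p are the n-dimensional basis elements strictly between a' and a'', then each f a_i is a sequence bridging f a' and f a'', and f a_1 ≤ … ≤ f a_p. -/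
/-- The data of a globular set: a dimension function together with
source (`src`) and target (`tgt`) operations. -/
structure GlobData where
  X : Type
  dim : X → ℕ
  src : X → X
  tgt : X → X

namespace GlobData

/-- The generating relation: `∂⁻y < y` (for `|y| > 0`) and `x < ∂⁺x` (for `|x| > 0`). -/
def rel (G : GlobData) (x y : G.X) : Prop :=
  (0 < G.dim y ∧ x = G.src y) ∨ (0 < G.dim x ∧ y = G.tgt x)

/-- The transitive closure of the generating relation. -/
def lt (G : GlobData) : G.X → G.X → Prop :=
  Relation.TransGen G.rel

def le (G : GlobData) (x y : G.X) : Prop :=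
  G.lt x y ∨ x = y

end GlobData

/-- A simple globular set: nonempty, finite, the source/target operations lower
dimension by one, the globular identities hold, and the transitive closure of the
generating relation is a (strict) total ordering. -/
def IsSimpleGlobular (G : GlobData) : Prop :=
  Nonempty G.X ∧ Finite G.X ∧
  (∀ x, 0 < G.dim x → G.dim (G.src x) + 1 = G.dim x) ∧
  (∀ x, 0 < G.dim x → G.dim (G.tgt x) + 1 = G.dim x) ∧
  (∀ x, 2 ≤ G.dim x → G.src (G.src x) = G.src (G.tgt x)) ∧
  (∀ x, 2 ≤ G.dim x → G.tgt (G.src x) = G.tgt (G.tgt x)) ∧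
  (∀ x, ¬ G.lt x x) ∧
  (∀ x y, G.lt x y ∨ x = y ∨ G.lt y x)

/-- The data of an augmented directed complex with basis: a graded set `B` of basis
elements, the boundary `d b` of each basis element (a finitely supported `ℤ`-linear
combination of basis elements), and the augmentation `eps b` of each basis element
(only relevant in dimension `0`).  The chain group `K_q` is the free abelian group
on the basis elements of dimension `q` and the distinguished submonoid `K_q*` is the
set of nonnegative combinations of such basis elements. -/
structure PreADC where
  B : Type
  dim : B → ℕ
  d : B → (B →₀ ℤ)
  eps : B → ℤ

namespace PreADC

/-- The positive part `∂⁺x` of a chain. -/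
noncomputable def posPart {B : Type} (x : B →₀ ℤ) : B →₀ ℤ :=
  Finsupp.mapRange (fun c => max c 0) (by simp) x

/-- The negative part `∂⁻x` of a chain. -/
noncomputable def negPart {B : Type} (x : B →₀ ℤ) : B →₀ ℤ :=
  Finsupp.mapRange (fun c => max (-c) 0) (by simp) x

/-- The boundary of a chain, extended linearly from basis elements. -/
noncomputable def bnd (K : PreADC) (x : K.B →₀ ℤ) : K.B →₀ ℤ :=
  x.sum fun a c => c • K.d a

/-- The augmentation of a chain (applied to its degree-zero part). -/
noncomputable def aug (K : PreADC) (x : K.B →₀ ℤ) : ℤ :=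
  x.sum fun a c => if K.dim a = 0 then c * K.eps a else 0

/-- `∂⁻` of a chain. -/
noncomputable def dMinus (K : PreADC) (x : K.B →₀ ℤ) : K.B →₀ ℤ :=
  negPart (K.bnd x)

/-- `∂⁺` of a chain. -/
noncomputable def dPlus (K : PreADC) (x : K.B →₀ ℤ) : K.B →₀ ℤ :=
  posPart (K.bnd x)

/-- The axioms of an augmented directed complex with basis: the boundary of a basis
element lowers dimension by exactly one (and vanishes in dimension `0`), `∂∂ = 0`,
and `ε∂ = 0`. -/
def IsADC (K : PreADC) : Prop :=
  (∀ b, K.dim b = 0 → K.d b = 0) ∧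
  (∀ b a, (K.d b) a ≠ 0 → K.dim a + 1 = K.dim b) ∧
  (∀ b, K.bnd (K.d b) = 0) ∧
  (∀ b, K.dim b = 1 → K.aug (K.d b) = 0)

/-- The basis is unital: `ε((∂⁻)^{|b|} b) = ε((∂⁺)^{|b|} b) = 1` for all basis elements. -/
def Unital (K : PreADC) : Prop :=
  ∀ b : K.B,
    K.aug ((K.dMinus)^[K.dim b] (Finsupp.single b 1)) = 1 ∧
    K.aug ((K.dPlus)^[K.dim b] (Finsupp.single b 1)) = 1

/-- The basis is loop-free: for each `q` there is a (strict) partial ordering `r`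
such that `a r b` whenever `a` is a term of `(∂⁻)^{|b|-q} b` with `|b| > q`, or `b`
is a term of `(∂⁺)^{|a|-q} a` with `|a| > q`. -/
def LoopFree (K : PreADC) : Prop :=
  ∀ q : ℕ, ∃ r : K.B → K.B → Prop,
    (∀ a b c, r a b → r b c → r a c) ∧ (∀ a, ¬ r a a) ∧
    (∀ a b, q < K.dim b → ((K.dMinus)^[K.dim b - q] (Finsupp.single b 1)) a ≠ 0 → r a b) ∧
    (∀ a b, q < K.dim a → ((K.dPlus)^[K.dim a - q] (Finsupp.single a 1)) b ≠ 0 → r a b)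

/-- The basis is strongly loop-free: there is a (strict) partial ordering `r` on the
whole basis such that `a r b` whenever `a` is a term of `∂⁻b` or `b` is a term of `∂⁺a`. -/
def StronglyLoopFree (K : PreADC) : Prop :=
  ∃ r : K.B → K.B → Prop,
    (∀ a b c, r a b → r b c → r a c) ∧ (∀ a, ¬ r a a) ∧
    (∀ a b, (negPart (K.d b)) a ≠ 0 → r a b) ∧
    (∀ a b, (posPart (K.d a)) b ≠ 0 → r a b)

/-- `f` (given by its values on basis elements, extended linearly) is a chain map
preserving the grading and taking sums of basis elements to sums of basis elements
(equivalently `f(K_q*) ⊆ L_q*`). -/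
def IsMor (K L : PreADC) (f : K.B → (L.B →₀ ℤ)) : Prop :=
  (∀ b a, (f b) a ≠ 0 → L.dim a = K.dim b) ∧
  (∀ b, ((K.d b).sum fun a c => c • f a) = L.bnd (f b)) ∧
  (∀ b a, 0 ≤ (f b) a)

/-- A morphism of augmented directed complexes: a chain map as in `IsMor` which is
moreover augmentation-preserving. -/
def IsAugMor (K L : PreADC) (f : K.B → (L.B →₀ ℤ)) : Prop :=
  IsMor K L f ∧ ∀ b, K.dim b = 0 → L.aug (f b) = K.eps b

end PreADC

/-- The simple augmented directed complex generated by a (simple) globular set: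
basis the elements of `X`, `∂x = ∂⁺x - ∂⁻x` for positive-dimensional `x`,
and `εx = 1` on zero-dimensional basis elements. -/
noncomputable def GlobData.toADC (G : GlobData) : PreADC where
  B := G.X
  dim := G.dim
  d := fun b =>
    if 0 < G.dim b then
      Finsupp.single (G.tgt b) 1 - Finsupp.single (G.src b) 1
    else 0
  eps := fun _ => 1

/-- An ordered sequence of `n`-dimensional basis elements. -/
def OrderedSeq (G : GlobData) (n : ℕ) (l : List G.X) : Prop :=
  (∀ a ∈ l, G.dim a = n) ∧ l.Chain' G.le

/-- A separated sequence of `n`-dimensional basis elements: ordered, and each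
consecutive pair of terms encloses a basis element of dimension `< n`. -/
def SeparatedSeq (G : GlobData) (n : ℕ) (l : List G.X) : Prop :=
  OrderedSeq G n l ∧ l.Chain' (fun a b => ∃ c, G.lt a c ∧ G.lt c b ∧ G.dim c < n)

/-- The element of `K_n*` corresponding to a sequence of basis elements:
the sum of its terms. -/
noncomputable def chainOf (G : GlobData) (l : List G.X) : G.X →₀ ℤ :=
  (l.map fun a => Finsupp.single a (1 : ℤ)).sum

/-- The partial ordering of separated sequences of `n`-dimensional basis elements:
same length, termwise `≤`, and all basis elements strictly between corresponding
terms have dimension `≥ n`. -/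
def sepLe (G : GlobData) (n : ℕ) (l l' : List G.X) : Prop :=
  List.Forall₂ (fun a a' => G.le a a' ∧ ∀ c, G.lt a c → G.lt c a' → n ≤ G.dim c) l l'

/-- `Interleaves G n x y b` says: if `A` is the (strictly increasing) enumeration of
the `n`-dimensional basis elements `c` with `x ≤ c ≤ y`, then `b` interleaves `A`:
`b = (b_1, …, b_q)` with `A_{j-1} < b_j < A_j` for all `j`. -/
def Interleaves (G : GlobData) (n : ℕ) (x y : G.X) (b : List G.X) : Prop :=
  ∃ A : List G.X, A.Chain' G.lt ∧
    (∀ c, c ∈ A ↔ (G.dim c = n ∧ G.le x c ∧ G.le c y)) ∧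
    List.Forall₂ (fun (pr : G.X × G.X) c => G.lt pr.1 c ∧ G.lt c pr.2) (A.zip A.tail) b

/-- A sequence `b` of `(n+1)`-dimensional basis elements bridges the separated
sequences `a'` and `a''`: it is a concatenation of blocks, the `i`-th block
interleaving the `n`-dimensional elements between `a_i'` and `a_i''`. -/
def Bridges (G : GlobData) (n : ℕ) (a' a'' b : List G.X) : Prop :=
  a'.length = a''.length ∧
  (∀ c ∈ b, G.dim c = n + 1) ∧
  ∃ bs : List (List G.X), b = bs.flatten ∧
    List.Forall₂ (fun (pr : G.X × G.X) bi => Interleaves G n pr.1 pr.2 bi) (a'.zip a'') bs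

namespace GlobData

theorem lt.trans {G : GlobData} {x y z : G.X} (h : G.lt x y) (h' : G.lt y z) : G.lt x z :=
  Relation.TransGen.trans h h'

theorem le.trans_lt {G : GlobData} {x y z : G.X} (h : G.le x y) (h' : G.lt y z) : G.lt x z := by
  rcases h with h | rfl
  exacts [h.trans h', h']

theorem lt.trans_le {G : GlobData} {x y z : G.X} (h : G.lt x y) (h' : G.le y z) : G.lt x z := by
  rcases h' with h' | rfl
  exacts [h.trans h', h]

theorem le.trans {G : GlobData} {x y z : G.X} (h : G.le x y) (h' : G.le y z) : G.le x z := by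
  rcases h with h | rfl
  exacts [Or.inl (h.trans_le h'), h']

theorem lt.le {G : GlobData} {x y : G.X} (h : G.lt x y) : G.le x y := Or.inl h

theorem le.refl {G : GlobData} (x : G.X) : G.le x x := Or.inr rfl

theorem src_lt {G : GlobData} {x : G.X} (h : 0 < G.dim x) : G.lt (G.src x) x :=
  .single (Or.inl ⟨h, rfl⟩)

theorem lt_tgt {G : GlobData} {x : G.X} (h : 0 < G.dim x) : G.lt x (G.tgt x) :=
  .single (Or.inr ⟨h, rfl⟩)

theorem lt.rel_of_covBy {G : GlobData} {x y : G.X} (h : G.lt x y)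
    (hc : ∀ z, G.lt x z → ¬ G.lt z y) : G.rel x y := by
  rcases Relation.TransGen.head'_iff.1 h with ⟨z, hxz, hzy⟩
  rcases Relation.reflTransGen_iff_eq_or_transGen.1 hzy with rfl | hzy
  · exact hxz
  · exact absurd hzy (hc z (.single hxz))

end GlobData

namespace IsSimpleGlobular

variable {G : GlobData}

theorem lt_irrefl (hG : IsSimpleGlobular G) (x : G.X) : ¬ G.lt x x := hG.2.2.2.2.2.2.1 x

theorem lt_or_le (hG : IsSimpleGlobular G) (x y : G.X) : G.lt x y ∨ G.le y x := by
  rcases hG.2.2.2.2.2.2.2 x y with h | rfl | h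
  exacts [.inl h, .inr (.refl _), .inr h.le]

theorem not_lt_of_le (hG : IsSimpleGlobular G) {x y : G.X} (h : G.le x y) : ¬ G.lt y x :=
  fun h' => hG.lt_irrefl _ (h.trans_lt h')

theorem le_antisymm (hG : IsSimpleGlobular G) {x y : G.X} (h : G.le x y) (h' : G.le y x) :
    x = y := by
  rcases h with h | h
  exacts [absurd h (hG.not_lt_of_le h'), h]

theorem dim_src (hG : IsSimpleGlobular G) {x : G.X} (h : 0 < G.dim x) :
    G.dim (G.src x) + 1 = G.dim x := hG.2.2.1 x h

theorem dim_tgt (hG : IsSimpleGlobular G) {x : G.X} (h : 0 < G.dim x) :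
    G.dim (G.tgt x) + 1 = G.dim x := hG.2.2.2.1 x h

theorem src_src (hG : IsSimpleGlobular G) {x : G.X} (h : 2 ≤ G.dim x) :
    G.src (G.src x) = G.src (G.tgt x) := hG.2.2.2.2.1 x h

theorem tgt_src (hG : IsSimpleGlobular G) {x : G.X} (h : 2 ≤ G.dim x) :
    G.tgt (G.src x) = G.tgt (G.tgt x) := hG.2.2.2.2.2.1 x h

theorem wellFounded_lt (hG : IsSimpleGlobular G) : WellFounded G.lt := by
  have := hG.2.1
  have : IsTrans G.X G.lt := ⟨fun _ _ _ h h' => h.trans h'⟩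
  have : Std.Irrefl G.lt := ⟨hG.lt_irrefl⟩
  exact Finite.wellFounded_of_trans_of_irrefl _

theorem wellFounded_gt (hG : IsSimpleGlobular G) : WellFounded (flip G.lt) := by
  have := hG.2.1
  have : IsTrans G.X (flip G.lt) := ⟨fun _ _ _ h h' => GlobData.lt.trans h' h⟩
  have : Std.Irrefl (flip G.lt) := ⟨hG.lt_irrefl⟩
  exact Finite.wellFounded_of_trans_of_irrefl _

theorem exists_succ (hG : IsSimpleGlobular G) {x y : G.X} (h : G.lt x y) :
    ∃ z, G.lt x z ∧ G.le z y ∧ G.rel x z := by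
  obtain ⟨z, hxz, hz⟩ := hG.wellFounded_lt.has_min {z | G.lt x z} ⟨y, h⟩
  refine ⟨z, hxz, ?_, GlobData.lt.rel_of_covBy hxz hz⟩
  rcases hG.lt_or_le y z with h' | h'
  exacts [absurd h' (hz y h), h']

theorem exists_pred (hG : IsSimpleGlobular G) {x y : G.X} (h : G.lt x y) :
    ∃ z, G.lt z y ∧ G.le x z ∧ G.rel z y := by
  obtain ⟨z, hzy, hz⟩ := hG.wellFounded_gt.has_min {z | G.lt z y} ⟨x, h⟩
  refine ⟨z, hzy, ?_, GlobData.lt.rel_of_covBy hzy fun w h₁ h₂ => hz w h₂ h₁⟩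
  rcases hG.lt_or_le z x with hzx | hxz
  exacts [absurd hzx (hz x h), hxz]

/-- `src x` is the last element before `x` of smaller dimension. -/
theorem dim_le_of_src_lt (hG : IsSimpleGlobular G) (x : G.X) (hx : 0 < G.dim x) :
    ∀ c, G.lt (G.src x) c → G.lt c x → G.dim x ≤ G.dim c := by
  induction x using hG.wellFounded_lt.induction with
  | _ x ih =>
    intro c hc hcx
    obtain ⟨p, hpx, hcp, ⟨-, rfl⟩ | ⟨hp, rfl⟩⟩ := hG.exists_pred hcx
    · exact absurd hc (hG.not_lt_of_le hcp)
    · have h2 := hG.dim_tgt hp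
      have h3 := hG.dim_src hp
      rw [← hG.src_src (by omega)] at hc
      rcases hcp with hcp | rfl
      · rcases hG.lt_or_le (G.src p) c with h | h | rfl
        · have := ih p hpx hp c h hcp
          omega
        · have := ih (G.src p) ((GlobData.src_lt hp).trans hpx) (by omega) c hc h
          omega
        · omega
      · omega

/-- `tgt x` is the first element after `x` of smaller dimension. -/
theorem dim_le_of_lt_tgt (hG : IsSimpleGlobular G) (x : G.X) (hx : 0 < G.dim x) :
    ∀ c, G.lt x c → G.lt c (G.tgt x) → G.dim x ≤ G.dim c := by
  induction x using hG.wellFounded_gt.induction with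
  | _ x ih =>
    intro c hxc hc
    obtain ⟨p, hxp, hpc, ⟨hp, rfl⟩ | ⟨-, rfl⟩⟩ := hG.exists_succ hxc
    · have h2 := hG.dim_tgt hp
      have h3 := hG.dim_src hp
      rw [hG.tgt_src (by omega)] at hc
      rcases hpc with hpc | rfl
      · rcases hG.lt_or_le c (G.tgt p) with h | h | h
        · have := ih p hxp hp c hpc h
          omega
        · have := ih (G.tgt p) (hxp.trans (GlobData.lt_tgt hp)) (by omega) c h hc
          omega
        · subst h
          omega
      · omega
    · exact absurd hc (hG.not_lt_of_le hpc)

theorem dim_le_of_src_lt_of_lt_tgt (hG : IsSimpleGlobular G) {x c : G.X} (hx : 0 < G.dim x)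
    (h : G.lt (G.src x) c) (h' : G.lt c (G.tgt x)) : G.dim x ≤ G.dim c := by
  rcases hG.lt_or_le c x with h₁ | h₁ | rfl
  exacts [hG.dim_le_of_src_lt x hx c h h₁, hG.dim_le_of_lt_tgt x hx c h₁ h', le_rfl]

theorem eq_src (hG : IsSimpleGlobular G) {x c : G.X} (hc : G.dim c = G.dim x + 1)
    (hxc : G.lt x c) (h : ∀ z, G.lt x z → G.lt z c → G.dim c ≤ G.dim z) : x = G.src c := by
  have h0 : 0 < G.dim c := by omega
  have h1 := hG.dim_src h0
  rcases hG.2.2.2.2.2.2.2 x (G.src c) with h' | h' | h'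
  · have := h _ h' (GlobData.src_lt h0)
    omega
  · exact h'
  · have := hG.dim_le_of_src_lt c h0 x h' hxc
    omega

theorem eq_tgt (hG : IsSimpleGlobular G) {x c : G.X} (hc : G.dim c = G.dim x + 1)
    (hcx : G.lt c x) (h : ∀ z, G.lt c z → G.lt z x → G.dim c ≤ G.dim z) : x = G.tgt c := by
  have h0 : 0 < G.dim c := by omega
  have h1 := hG.dim_tgt h0
  rcases hG.2.2.2.2.2.2.2 x (G.tgt c) with h' | h' | h'
  · have := hG.dim_le_of_lt_tgt c h0 x hcx h'
    omega
  · exact h'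
  · have := h _ (GlobData.lt_tgt h0) h'
    omega

theorem exists_between (hG : IsSimpleGlobular G) {x y : G.X} (hxy : G.lt x y)
    (hd : G.dim x = G.dim y) (h : ∀ z, G.lt x z → G.lt z y → G.dim x + 1 ≤ G.dim z) :
    ∃ c, G.dim c = G.dim x + 1 ∧ x = G.src c ∧ y = G.tgt c := by
  obtain ⟨z, hxz, hzy, hr⟩ := hG.exists_succ hxy
  have hz : G.lt z y ∧ G.dim z = G.dim x + 1 := by
    rcases hr with ⟨hp, rfl⟩ | ⟨hp, rfl⟩
    · have := hG.dim_src hp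
      rcases hzy with hzy | rfl
      · exact ⟨hzy, by omega⟩
      · omega
    · have := hG.dim_tgt hp
      rcases hzy with hzy | rfl
      · have := h _ hxz hzy
        omega
      · omega
  refine ⟨z, hz.2, hG.eq_src hz.2 hxz fun w h₁ h₂ => ?_,
    hG.eq_tgt (by omega) hz.1 fun w h₁ h₂ => ?_⟩
  · have := h w h₁ (h₂.trans hz.1)
    omega
  · have := h w (hxz.trans h₁) h₂
    omega

/-- If `c` and `c'` are separated, the target of `c` weakly precedes the source of `c'`. -/
theorem tgt_le_src (hG : IsSimpleGlobular G) {c c' e : G.X} (h0 : 0 < G.dim c)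
    (hd : G.dim c' = G.dim c) (hce : G.lt c e) (hec : G.lt e c') (he : G.dim e < G.dim c) :
    G.le (G.tgt c) (G.src c') := by
  have h1 : G.le (G.tgt c) e := by
    rcases hG.lt_or_le e (G.tgt c) with h | h
    · have := hG.dim_le_of_lt_tgt c h0 e hce h
      omega
    · exact h
  have h2 : G.le e (G.src c') := by
    rcases hG.lt_or_le (G.src c') e with h | h
    · have := hG.dim_le_of_src_lt c' (by omega) e h hec
      omega
    · exact h
  exact h1.trans h2

end IsSimpleGlobular

/-- The number of elements of dimension less than `n` which precede `x`. -/
noncomputable def GlobData.level (G : GlobData) (n : ℕ) (x : G.X) : ℕ :=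
  {c | G.lt c x ∧ G.dim c < n}.ncard

namespace IsSimpleGlobular

variable {G : GlobData}

theorem level_mono (hG : IsSimpleGlobular G) (n : ℕ) {x y : G.X} (h : G.le x y) :
    G.level n x ≤ G.level n y := by
  have := hG.2.1
  exact Set.ncard_le_ncard (fun c hc => ⟨hc.1.trans_le h, hc.2⟩) (Set.toFinite _)

theorem lt_of_level_lt (hG : IsSimpleGlobular G) {n : ℕ} {x y : G.X}
    (h : G.level n x < G.level n y) : G.lt x y := by
  rcases hG.lt_or_le x y with h' | h'
  · exact h'
  · have := hG.level_mono n h'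
    omega

theorem level_lt (hG : IsSimpleGlobular G) {n : ℕ} {x y c : G.X} (h : G.lt x c) (h' : G.lt c y)
    (hc : G.dim c < n) : G.level n x < G.level n y := by
  have := hG.2.1
  refine Set.ncard_lt_ncard ⟨fun e he => ⟨he.1.trans (h.trans h'), he.2⟩, fun hs => ?_⟩
    (Set.toFinite _)
  exact hG.not_lt_of_le h.le (hs ⟨h', hc⟩ : c ∈ {c | G.lt c x ∧ G.dim c < n}).1

theorem level_src_eq_level_tgt (hG : IsSimpleGlobular G) {n : ℕ} {c : G.X}
    (hc : G.dim c = n + 1) : G.level n (G.src c) = G.level n (G.tgt c) := by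
  have h0 : 0 < G.dim c := by omega
  have hs := GlobData.src_lt h0
  have ht := GlobData.lt_tgt h0
  have hd := hG.dim_src h0
  refine _root_.le_antisymm (hG.level_mono n (hs.trans ht).le) ?_
  have := hG.2.1
  refine Set.ncard_le_ncard (fun e he => ⟨?_, he.2⟩) (Set.toFinite _)
  have h2 : G.dim e < n := he.2
  rcases hG.lt_or_le e (G.src c) with h | h | rfl
  · exact h
  · have := hG.dim_le_of_src_lt_of_lt_tgt h0 h he.1
    omega
  · omega

end IsSimpleGlobular

theorem SeparatedSeq.pairwise {G : GlobData} {n : ℕ} {l : List G.X} (h : SeparatedSeq G n l) :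
    l.Pairwise fun a b => ∃ c, G.lt a c ∧ G.lt c b ∧ G.dim c < n := by
  have : IsTrans G.X fun a b => ∃ c, G.lt a c ∧ G.lt c b ∧ G.dim c < n :=
    ⟨fun _ _ _ ⟨c, h₁, h₂, h₃⟩ ⟨_, h₄, h₅, _⟩ => ⟨c, h₁, h₂.trans (h₄.trans h₅), h₃⟩⟩
  exact List.isChain_iff_pairwise.1 h.2

theorem sepLe.refl {G : GlobData} (hG : IsSimpleGlobular G) (n : ℕ) (l : List G.X) :
    sepLe G n l l :=
  List.forall₂_same.2 fun _ _ =>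
    ⟨.refl _, fun _ h h' => absurd (h.trans h') (hG.lt_irrefl _)⟩

theorem sepLe.trans {G : GlobData} (hG : IsSimpleGlobular G) {n : ℕ} {l₁ l₂ l₃ : List G.X}
    (hd : ∀ a ∈ l₂, G.dim a = n) (h : sepLe G n l₁ l₂) (h' : sepLe G n l₂ l₃) :
    sepLe G n l₁ l₃ := by
  unfold sepLe at *
  induction h generalizing l₃ with
  | nil => cases h'; exact .nil
  | @cons a b _ _ hab _ ih =>
    cases h' with
    | cons hbc ht =>
      refine .cons ⟨hab.1.trans hbc.1, fun c h₁ h₂ => ?_⟩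
        (ih (fun a ha => hd a (List.mem_cons_of_mem _ ha)) ht)
      rcases hG.lt_or_le c b with h | h | rfl
      · exact hab.2 c h₁ h
      · exact hbc.2 c h h₂
      · exact (hd _ List.mem_cons_self).ge

section Chains

variable {G : GlobData}

@[simp]
theorem chainOf_nil : chainOf G [] = 0 := rfl

@[simp]
theorem chainOf_cons (a : G.X) (l : List G.X) :
    chainOf G (a :: l) = Finsupp.single a 1 + chainOf G l := by
  simp [chainOf]

@[simp]
theorem chainOf_append (l l' : List G.X) :
    chainOf G (l ++ l') = chainOf G l + chainOf G l' := by
  simp [chainOf]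

open Classical in
theorem chainOf_apply (l : List G.X) (a : G.X) : chainOf G l a = l.count a := by
  induction l with
  | nil => simp
  | cons b l ih =>
    by_cases h : b = a <;> simp [ih, h, add_comm]

theorem perm_of_chainOf_eq {l l' : List G.X} (h : chainOf G l = chainOf G l') : l.Perm l' := by
  classical
  refine List.perm_iff_count.2 fun a => ?_
  have := DFunLike.congr_fun h a
  rw [chainOf_apply, chainOf_apply] at this
  exact_mod_cast this

theorem mem_of_chainOf_ne_zero {l : List G.X} {a : G.X} (h : chainOf G l a ≠ 0) : a ∈ l := by
  classical
  rw [chainOf_apply] at h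
  exact List.count_pos_iff.1 (by omega)

theorem bnd_toADC (x : G.X →₀ ℤ) :
    G.toADC.bnd x = x.sum (N := G.X →₀ ℤ) fun a c => c • if 0 < G.dim a then
      Finsupp.single (G.tgt a) (1 : ℤ) - Finsupp.single (G.src a) 1 else 0 := rfl

theorem aug_toADC (x : G.X →₀ ℤ) :
    G.toADC.aug x = x.sum fun a c => if G.dim a = 0 then c * 1 else 0 := rfl

theorem bnd_chainOf {l : List G.X} (h : ∀ a ∈ l, 0 < G.dim a) :
    G.toADC.bnd (chainOf G l) = chainOf G (l.map G.tgt) - chainOf G (l.map G.src) := by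
  refine (bnd_toADC _).trans ?_
  change @Eq (G.X →₀ ℤ) _ _
  induction l with
  | nil => simp
  | cons b l ih =>
    rw [chainOf_cons, Finsupp.sum_add_index' (by simp) (fun _ _ _ => add_smul _ _ _),
      ih fun a ha => h a (List.mem_cons_of_mem _ ha), Finsupp.sum_single_index (by simp),
      if_pos (h b List.mem_cons_self), one_smul, List.map_cons, List.map_cons, chainOf_cons,
      chainOf_cons]
    abel

theorem bnd_chainOf_of_dim_eq_zero {l : List G.X} (h : ∀ a ∈ l, G.dim a = 0) :
    G.toADC.bnd (chainOf G l) = 0 := by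
  refine (bnd_toADC _).trans ?_
  change @Eq (G.X →₀ ℤ) _ 0
  refine Finset.sum_eq_zero fun a ha => ?_
  simp [h a (mem_of_chainOf_ne_zero (Finsupp.mem_support_iff.1 ha))]

theorem aug_chainOf {l : List G.X} (h : ∀ a ∈ l, G.dim a = 0) :
    G.toADC.aug (chainOf G l) = l.length := by
  rw [aug_toADC]
  induction l with
  | nil => simp
  | cons b l ih =>
    rw [chainOf_cons, Finsupp.sum_add_index' (by simp) (by intros; split_ifs <;> ring),
      ih fun a ha => h a (List.mem_cons_of_mem _ ha), Finsupp.sum_single_index (by simp)]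
    simp [h b, add_comm]

end Chains

theorem Interleaves.self {G : GlobData} (hG : IsSimpleGlobular G) {n : ℕ} {x : G.X}
    (hx : G.dim x = n) : Interleaves G n x x [] := by
  refine ⟨[x], List.isChain_singleton _, fun c => ?_, by simp⟩
  rw [List.mem_singleton]
  constructor
  · rintro rfl
    exact ⟨hx, .refl _, .refl _⟩
  · exact fun h => hG.le_antisymm h.2.2 h.2.1

theorem Interleaves.cons {G : GlobData} (hG : IsSimpleGlobular G) {n : ℕ} {y c : G.X}
    {b : List G.X} (hc : G.dim c = n + 1) (hy : G.le (G.tgt c) y)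
    (h : Interleaves G n (G.tgt c) y b) : Interleaves G n (G.src c) y (c :: b) := by
  have h0 : 0 < G.dim c := by omega
  have hs := GlobData.src_lt h0
  have ht := GlobData.lt_tgt h0
  have hds := hG.dim_src h0
  have hdt := hG.dim_tgt h0
  obtain ⟨A, hA, hmem, hf⟩ := h
  cases A with
  | nil => exact absurd ((hmem (G.tgt c)).2 ⟨by omega, .refl _, hy⟩) List.not_mem_nil
  | cons a A =>
    have ha := ((hmem a).1 List.mem_cons_self).2.1
    refine ⟨G.src c :: a :: A, List.IsChain.cons_cons ((hs.trans ht).trans_le ha) hA,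
      fun e => ?_, .cons ⟨hs, ht.trans_le ha⟩ hf⟩
    rw [List.mem_cons, hmem]
    constructor
    · rintro (rfl | ⟨h₁, h₂, h₃⟩)
      · exact ⟨by omega, .refl _, ((hs.trans ht).trans_le hy).le⟩
      · exact ⟨h₁, ((hs.trans ht).trans_le h₂).le, h₃⟩
    · rintro ⟨h₁, h₂ | h₂, h₃⟩
      · rcases hG.lt_or_le e (G.tgt c) with h | h
        · have := hG.dim_le_of_src_lt_of_lt_tgt h0 h₂ h
          omega
        · exact .inr ⟨h₁, h, h₃⟩
      · exact .inl h₂.symm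

/-- A separated sequence bridges any two sequences whose difference is its boundary. -/
theorem sepLe_and_bridging_of_perm {G : GlobData} (hG : IsSimpleGlobular G) {n : ℕ}
    (N : ℕ) {l l' m : List G.X} (hN : l.length + m.length = N)
    (hl : ∀ a ∈ l, G.dim a = n) (hm : ∀ a ∈ m, G.dim a = n + 1)
    (hsl : l.Pairwise fun a b => G.level n a < G.level n b)
    (hsl' : l'.Pairwise fun a b => G.level n a < G.level n b)
    (hsm : m.Pairwise fun a b => G.le (G.tgt a) (G.src b))
    (hll : List.Forall₂ (fun a b => G.level n a = G.level n b) l l')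
    (hp : (l' ++ m.map G.src).Perm (l ++ m.map G.tgt)) :
    sepLe G n l l' ∧ ∃ bs : List (List G.X), m = bs.flatten ∧
      List.Forall₂ (fun (pr : G.X × G.X) bi => Interleaves G n pr.1 pr.2 bi) (l.zip l') bs := by
  induction N generalizing l l' m with
  | zero =>
    obtain rfl : l = [] := List.length_eq_zero_iff.1 (by omega)
    obtain rfl : m = [] := List.length_eq_zero_iff.1 (by omega)
    cases hll
    exact ⟨.nil, [], rfl, .nil⟩
  | succ N ih =>
    have src_lt_tgt : ∀ c ∈ m, G.lt (G.src c) (G.tgt c) := fun c hc =>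
      (GlobData.src_lt (by rw [hm c hc]; omega)).trans (GlobData.lt_tgt (by rw [hm c hc]; omega))
    have src_not_mem : ∀ c m', m = c :: m' → G.src c ∉ m.map G.tgt := by
      rintro c m' rfl h
      obtain ⟨e, he, hec⟩ := List.mem_map.1 h
      have h1 := src_lt_tgt c List.mem_cons_self
      have h2 := src_lt_tgt e he
      rcases List.mem_cons.1 he with rfl | he
      · exact hG.lt_irrefl _ (hec ▸ h1)
      · exact hG.lt_irrefl _ (hec ▸ (h1.trans_le ((List.pairwise_cons.1 hsm).1 e he)).trans h2)
    cases hll with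
    | nil =>
      cases m with
      | nil => exact ⟨.nil, [], rfl, .nil⟩
      | cons c m' =>
        have h1 : G.src c ∈ [] ++ (c :: m').map G.src := by simp
        exact absurd (by simpa using hp.mem_iff.1 h1) (src_not_mem c m' rfl)
    | @cons x y xs ys hxy hrest =>
      have hsl1 := List.pairwise_cons.1 hsl
      have hsl1' := List.pairwise_cons.1 hsl'
      have hN' : xs.length + 1 + m.length = N + 1 := hN
      by_cases hne : x = y
      · subst hne
        obtain ⟨h1, bs, h2, h3⟩ := ih (l := xs) (l' := ys) (m := m) (by omega)
          (fun a ha => hl a (List.mem_cons_of_mem _ ha)) hm hsl1.2 hsl1'.2 hsm hrest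
          (by simpa using hp)
        refine ⟨.cons ⟨.refl _, fun _ h h' => absurd (h.trans h') (hG.lt_irrefl _)⟩ h1,
          [] :: bs, h2, .cons (.self hG (hl x List.mem_cons_self)) h3⟩
      · have hx : x ∈ m.map G.src := by
          have h1 : x ∈ (y :: ys) ++ m.map G.src := hp.mem_iff.2 (by simp)
          rcases List.mem_append.1 h1 with h1 | h1
          · rcases List.mem_cons.1 h1 with h1 | h1
            · exact absurd h1 hne
            · have := hsl1'.1 x h1
              omega
          · exact h1
        cases m with
        | nil => simp at hx
        | cons c m' =>
          have hsm1 := List.pairwise_cons.1 hsm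
          have hcx : x = G.src c := by
            have h1 : G.src c ∈ (x :: xs) ++ (c :: m').map G.tgt := hp.mem_iff.1 (by simp)
            rcases List.mem_append.1 h1 with h1 | h1
            · rcases List.mem_cons.1 h1 with h1 | h1
              · exact h1.symm
              · have h2 := hG.lt_of_level_lt (hsl1.1 _ h1)
                rw [List.map_cons, List.mem_cons] at hx
                rcases hx with hx | hx
                · exact hx
                · obtain ⟨e, he, rfl⟩ := List.mem_map.1 hx
                  have h3 := (src_lt_tgt c List.mem_cons_self).trans_le (hsm1.1 e he)
                  exact absurd h2 (hG.not_lt_of_le h3.le)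
            · exact absurd h1 (src_not_mem c m' rfl)
          subst hcx
          have hdc := hm c List.mem_cons_self
          have h0 : 0 < G.dim c := by omega
          have hlev := hG.level_src_eq_level_tgt hdc
          have hdt := hG.dim_tgt h0
          have hp' : ((y :: ys) ++ m'.map G.src).Perm ((G.tgt c :: xs) ++ m'.map G.tgt) := by
            classical
            rw [List.perm_iff_count] at hp ⊢
            intro a
            have := hp a
            simp only [List.map_cons, List.cons_append, List.count_cons, List.count_append]
              at this ⊢
            omega
          obtain ⟨h1, bs, h2, h3⟩ := ih (l := G.tgt c :: xs) (l' := y :: ys) (m := m')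
            (by simp only [List.length_cons] at hN' ⊢; omega)
            (by
              intro a ha
              rcases List.mem_cons.1 ha with rfl | ha
              · omega
              · exact hl a (List.mem_cons_of_mem _ ha))
            (fun a ha => hm a (List.mem_cons_of_mem _ ha))
            (List.pairwise_cons.2 ⟨fun a ha => hlev ▸ hsl1.1 a ha, hsl1.2⟩) hsl' hsm1.2
            (.cons (hlev ▸ hxy) hrest) hp'
          cases h1 with
          | cons h1 h1' =>
          cases h3 with
          | @cons _ b _ bs h3 h3' =>
            refine ⟨.cons ⟨((src_lt_tgt c List.mem_cons_self).trans_le h1.1).le,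
              fun e he he' => ?_⟩ h1', (c :: b) :: bs, by simp [h2],
              .cons (.cons hG hdc h1.1 h3) h3'⟩
            by_contra hlt
            have := hG.level_lt he he' (not_le.1 hlt)
            omega

theorem sepLe_and_bridges_of_bnd_eq {G : GlobData} (hG : IsSimpleGlobular G) {n : ℕ}
    {l l' m : List G.X} (hl : SeparatedSeq G n l) (hl' : SeparatedSeq G n l')
    (hm : SeparatedSeq G (n + 1) m)
    (h : chainOf G l' - chainOf G l = G.toADC.bnd (chainOf G m)) :
    sepLe G n l l' ∧ Bridges G n l l' m := by
  have hdm := hm.1.1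
  rw [bnd_chainOf fun a ha => by rw [hdm a ha]; omega, sub_eq_sub_iff_add_eq_add,
    ← chainOf_append, add_comm, ← chainOf_append] at h
  have hp := perm_of_chainOf_eq h
  have hp' : (l' ++ m.map G.src).Perm (l ++ m.map G.tgt) := hp
  have hlev : ∀ k : List G.X, SeparatedSeq G n k →
      k.Pairwise fun a b => G.level n a < G.level n b := fun k hk =>
    hk.pairwise.imp fun ⟨c, h₁, h₂, h₃⟩ => hG.level_lt h₁ h₂ h₃
  have hperm : (l.map (G.level n)).Perm (l'.map (G.level n)) := by
    have h1 := hp'.map (G.level n)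
    have h2 : (m.map G.src).map (G.level n) = (m.map G.tgt).map (G.level n) := by
      rw [List.map_map, List.map_map]
      exact List.map_congr_left fun c hc => hG.level_src_eq_level_tgt (hdm c hc)
    rw [List.map_append, List.map_append, h2, List.perm_append_right_iff] at h1
    exact h1.symm
  have heq : l.map (G.level n) = l'.map (G.level n) :=
    hperm.eq_of_pairwise (le := (· < ·)) (fun a b _ _ h h' => absurd h (lt_asymm h'))
      (List.pairwise_map.2 (hlev l hl)) (List.pairwise_map.2 (hlev l' hl'))
  have hll : List.Forall₂ (fun a b => G.level n a = G.level n b) l l' := by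
    rw [← List.forall₂_eq_eq_eq, List.forall₂_map_left_iff, List.forall₂_map_right_iff] at heq
    exact heq
  have hsm : m.Pairwise fun a b => G.le (G.tgt a) (G.src b) := by
    refine hm.pairwise.imp_of_mem fun {a b} ha hb hab => ?_
    obtain ⟨c, h₁, h₂, h₃⟩ := hab
    have hda := hdm a ha
    have hdb := hdm b hb
    exact hG.tgt_le_src (by omega) (by omega) h₁ h₂ (by omega)
  obtain ⟨h1, h2⟩ := sepLe_and_bridging_of_perm hG _ rfl hl.1.1 hdm (hlev l hl) (hlev l' hl')
    hsm hll hp'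
  exact ⟨h1, h1.length_eq, hdm, h2⟩

theorem Interleaves.chainOf_eq {G : GlobData} (hG : IsSimpleGlobular G) {n : ℕ} {x y : G.X}
    {b : List G.X} (hx : G.dim x = n) (hy : G.dim y = n) (hxy : G.le x y)
    (hdim : ∀ c, G.lt x c → G.lt c y → n ≤ G.dim c) (hb : ∀ c ∈ b, G.dim c = n + 1)
    (h : Interleaves G n x y b) :
    Finsupp.single y 1 + chainOf G (b.map G.src) =
      Finsupp.single x 1 + chainOf G (b.map G.tgt) := by
  obtain ⟨A, hA, hmem, hf⟩ := h
  have : IsTrans G.X G.lt := ⟨fun _ _ _ h h' => h.trans h'⟩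
  replace hA : A.Pairwise G.lt := List.isChain_iff_pairwise.1 hA
  induction A generalizing x b with
  | nil => exact absurd ((hmem x).2 ⟨hx, .refl _, hxy⟩) List.not_mem_nil
  | cons a A ih =>
    have hA1 := List.pairwise_cons.1 hA
    obtain rfl : x = a := by
      have h1 := ((hmem a).1 List.mem_cons_self).2.1
      rcases List.mem_cons.1 ((hmem x).2 ⟨hx, .refl _, hxy⟩) with h | h
      · exact h
      · exact absurd (hA1.1 x h) (hG.not_lt_of_le h1)
    cases A with
    | nil =>
      cases hf
      obtain rfl : y = x := by simpa using (hmem y).2 ⟨hy, hxy, .refl _⟩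
      rfl
    | cons a' A =>
      cases hf with
      | @cons _ c _ b hc hf =>
        obtain ⟨hxc, hca : G.lt c a'⟩ := hc
        have hdc := hb c List.mem_cons_self
        have hxa : G.lt x a' := hxc.trans hca
        obtain ⟨hda, -, hay⟩ := (hmem a').1 (by simp)
        have hA2 := List.pairwise_cons.1 hA1.2
        have hdim' : ∀ z, G.lt x z → G.lt z a' → n + 1 ≤ G.dim z := by
          intro z h₁ h₂
          have h3 := hdim z h₁ (h₂.trans_le hay)
          by_contra hlt
          have h4 := (hmem z).2 ⟨by omega, h₁.le, (h₂.trans_le hay).le⟩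
          rcases List.mem_cons.1 h4 with rfl | h4
          · exact hG.lt_irrefl _ h₁
          rcases List.mem_cons.1 h4 with rfl | h4
          · exact hG.lt_irrefl _ h₂
          · exact hG.not_lt_of_le h₂.le (hA2.1 z h4)
        have hsrc : x = G.src c := hG.eq_src (by omega) hxc fun z h₁ h₂ => by
          have := hdim' z h₁ (h₂.trans hca)
          omega
        have htgt : a' = G.tgt c := hG.eq_tgt (by omega) hca fun z h₁ h₂ => by
          have := hdim' z (hxc.trans h₁) h₂
          omega
        have h1 := ih (x := a') (b := b) hda hay (fun z h₁ h₂ => hdim z (hxa.trans h₁) h₂)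
          (fun z hz => hb z (List.mem_cons_of_mem _ hz))
          (fun z => by
            constructor
            · intro hz
              obtain ⟨h₁, -, h₃⟩ := (hmem z).1 (List.mem_cons_of_mem _ hz)
              refine ⟨h₁, ?_, h₃⟩
              rcases List.mem_cons.1 hz with rfl | hz
              exacts [.refl _, (hA2.1 z hz).le]
            · rintro ⟨h₁, h₂, h₃⟩
              rcases List.mem_cons.1 ((hmem z).2 ⟨h₁, (hxa.trans_le h₂).le, h₃⟩) with rfl | h
              · exact absurd hxa (hG.not_lt_of_le h₂)
              · exact h)
          hf hA1.2
        rw [List.map_cons, List.map_cons, chainOf_cons, chainOf_cons, ← hsrc, ← htgt, ← h1]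
        abel

theorem Bridges.bnd_eq {G : GlobData} (hG : IsSimpleGlobular G) {n : ℕ} {l l' m : List G.X}
    (hl : ∀ a ∈ l, G.dim a = n) (hl' : ∀ a ∈ l', G.dim a = n) (hle : sepLe G n l l')
    (h : Bridges G n l l' m) :
    chainOf G l' - chainOf G l = G.toADC.bnd (chainOf G m) := by
  obtain ⟨-, hdm, bs, rfl, hf⟩ := h
  rw [bnd_chainOf fun a ha => by rw [hdm a ha]; omega, sub_eq_sub_iff_add_eq_add,
    add_comm (chainOf G (List.map G.tgt _))]
  unfold sepLe at hle
  induction hle generalizing bs with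
  | nil => cases hf; rfl
  | @cons x y xs ys hxy _ ih =>
    cases hf with
    | @cons _ b _ bs hb hf =>
      have h1 := ih (fun a ha => hl a (List.mem_cons_of_mem _ ha))
        (fun a ha => hl' a (List.mem_cons_of_mem _ ha)) bs
        hf (fun a ha => hdm a (by rw [List.flatten_cons]; exact List.mem_append_right _ ha))
      have h2 := Interleaves.chainOf_eq hG (hl x List.mem_cons_self) (hl' y List.mem_cons_self)
        hxy.1 hxy.2
        (fun a ha => hdm a (by rw [List.flatten_cons]; exact List.mem_append_left _ ha)) hb
      simp only [List.flatten_cons, List.map_append, chainOf_append, chainOf_cons]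
      rw [add_add_add_comm, h1, h2, add_add_add_comm]

theorem sepLe_of_forall_covering {G H : GlobData} (hG : IsSimpleGlobular G)
    (hH : IsSimpleGlobular H) {f : G.X → List H.X} (hf : ∀ a, ∀ x ∈ f a, H.dim x = G.dim a)
    (hstep : ∀ c, 0 < G.dim c → sepLe H (G.dim (G.src c)) (f (G.src c)) (f (G.tgt c)))
    {n : ℕ} {a b : G.X} (ha : G.dim a = n) (hb : G.dim b = n) (hab : G.le a b)
    (h : ∀ c, G.lt a c → G.lt c b → n ≤ G.dim c) : sepLe H n (f a) (f b) := by
  induction a using hG.wellFounded_gt.induction with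
  | _ a ih =>
    rcases hab with hab | rfl
    · obtain ⟨e, ⟨hae, hde⟩, hmin⟩ :=
        hG.wellFounded_lt.has_min {e | G.lt a e ∧ G.dim e = n} ⟨b, hab, hb⟩
      have heb : G.le e b := by
        rcases hG.lt_or_le b e with h' | h'
        exacts [absurd h' (hmin b ⟨hab, hb⟩), h']
      obtain ⟨c, hdc, rfl, rfl⟩ := hG.exists_between hae (by omega) fun z h₁ h₂ => by
        have h3 := h z h₁ (h₂.trans_le heb)
        by_contra hlt
        exact hmin z ⟨h₁, by omega⟩ h₂
      have h1 := hstep c (by omega)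
      rw [ha] at h1
      exact h1.trans hH (fun x hx => by rw [hf _ x hx, hde])
        (ih _ hae hde heb fun z h₁ h₂ => h z (hae.trans h₁) h₂)
    · exact .refl hH _ _

theorem sum_d_smul_chainOf {G H : GlobData} (f : G.X → List H.X) {b : G.X} (hb : 0 < G.dim b) :
    ((G.toADC.d b).sum fun a c => c • chainOf H (f a)) =
      chainOf H (f (G.tgt b)) - chainOf H (f (G.src b)) := by
  change (Finsupp.sum (if 0 < G.dim b then
      Finsupp.single (G.tgt b) (1 : ℤ) - Finsupp.single (G.src b) 1 else 0 : G.X →₀ ℤ)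
    fun a c => c • chainOf H (f a)) = _
  rw [if_pos hb, Finsupp.sum_sub_index (by simp [sub_smul]), Finsupp.sum_single_index (by simp),
    Finsupp.sum_single_index (by simp), one_smul, one_smul]

theorem sum_d_smul_chainOf_of_dim_eq_zero {G H : GlobData} (f : G.X → List H.X) {b : G.X}
    (hb : G.dim b = 0) : ((G.toADC.d b).sum fun a c => c • chainOf H (f a)) = 0 := by
  change (Finsupp.sum (if 0 < G.dim b then
      Finsupp.single (G.tgt b) (1 : ℤ) - Finsupp.single (G.src b) 1 else 0 : G.X →₀ ℤ)
    fun a c => c • chainOf H (f a)) = _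
  rw [if_neg hb.not_gt, Finsupp.sum_zero_index]

/-- A function assigning separated sequences in `L` to basis elements of `K` extends
(linearly) to a morphism of augmented directed complexes if and only if:
(i) zero-dimensional basis elements go to singletons, monotonically; and
(ii) whenever `a' < a''` are `n`-dimensional basis elements all of whose strictly
intermediate elements have dimension `≥ n+1`, the `(n+1)`-dimensional elements
between them go, monotonically, to sequences bridging `f a'` and `f a''`. -/
theorem stmt12 (G H : GlobData) (hG : IsSimpleGlobular G) (hH : IsSimpleGlobular H)
    (f : G.X → List H.X)
    (hf : ∀ a, SeparatedSeq H (G.dim a) (f a)) :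
    PreADC.IsAugMor G.toADC H.toADC (fun a => chainOf H (f a)) ↔
      ((∀ a, G.dim a = 0 → (f a).length = 1) ∧
       (∀ a a', G.dim a = 0 → G.dim a' = 0 → G.le a a' → sepLe H 0 (f a) (f a')) ∧
       (∀ (n : ℕ) (a' a'' : G.X), G.dim a' = n → G.dim a'' = n → G.lt a' a'' →
          (∀ c, G.lt a' c → G.lt c a'' → n + 1 ≤ G.dim c) →
          (∀ a, G.dim a = n + 1 → G.lt a' a → G.lt a a'' →
            Bridges H n (f a') (f a'') (f a)) ∧
          (∀ a b, G.dim a = n + 1 → G.lt a' a → G.lt a a'' →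
            G.dim b = n + 1 → G.lt a' b → G.lt b a'' → G.le a b →
            sepLe H (n + 1) (f a) (f b)))) := by
  have hdf : ∀ a, ∀ x ∈ f a, H.dim x = G.dim a := fun a => (hf a).1.1
  constructor
  · rintro ⟨⟨-, hchain, -⟩, haug⟩
    have key : ∀ c, 0 < G.dim c →
        sepLe H (G.dim (G.src c)) (f (G.src c)) (f (G.tgt c)) ∧
          Bridges H (G.dim (G.src c)) (f (G.src c)) (f (G.tgt c)) (f c) := by
      intro c hc
      have hs := hG.dim_src hc
      have ht := hG.dim_tgt hc
      have h1 := hf (G.tgt c)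
      have h2 := hf c
      rw [show G.dim (G.tgt c) = G.dim (G.src c) by omega] at h1
      rw [← hs] at h2
      exact sepLe_and_bridges_of_bnd_eq hH (hf (G.src c)) h1 h2
        ((sum_d_smul_chainOf f hc).symm.trans (hchain c))
    have mono : ∀ {n : ℕ} {a b : G.X}, G.dim a = n → G.dim b = n → G.le a b →
        (∀ c, G.lt a c → G.lt c b → n ≤ G.dim c) → sepLe H n (f a) (f b) :=
      sepLe_of_forall_covering hG hH hdf fun c hc => (key c hc).1
    refine ⟨fun a ha => ?_, fun a a' ha ha' hle => mono ha ha' hle fun _ _ _ => Nat.zero_le _,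
      fun n a' a'' ha' ha'' hlt hbetween => ⟨fun a ha h₁ h₂ => ?_,
        fun a b ha h₁ h₂ hb h₃ h₄ hle => mono ha hb hle
          fun c h₅ h₆ => hbetween c (h₁.trans h₅) (h₆.trans h₄)⟩⟩
    · have h1 := haug a ha
      rw [aug_chainOf fun x hx => (hdf a x hx).trans ha] at h1
      exact Nat.cast_injective h1
    · have h3 : a' = G.src a := hG.eq_src (by omega) h₁ fun z h h' => by
        have := hbetween z h (h'.trans h₂)
        omega
      have h4 : a'' = G.tgt a := hG.eq_tgt (by omega) h₂ fun z h h' => by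
        have := hbetween z (h₁.trans h) h'
        omega
      subst h3 h4
      exact ha' ▸ (key a (by omega)).2
  · rintro ⟨hlen, hmono, hbr⟩
    refine ⟨⟨fun b a h => hdf b a (mem_of_chainOf_ne_zero h), fun b => ?_, fun b a => ?_⟩,
      fun b hb => ?_⟩
    · rcases Nat.eq_zero_or_pos (G.dim b) with h0 | h0
      · exact (sum_d_smul_chainOf_of_dim_eq_zero f h0).trans
          (bnd_chainOf_of_dim_eq_zero fun x hx => (hdf b x hx).trans h0).symm
      · have hs := GlobData.src_lt h0
        have ht := GlobData.lt_tgt h0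
        have hds := hG.dim_src h0
        have hdt := hG.dim_tgt h0
        obtain ⟨n, hn⟩ : ∃ n, G.dim b = n + 1 := ⟨_, hds.symm⟩
        have hsn : G.dim (G.src b) = n := by omega
        have htn : G.dim (G.tgt b) = n := by omega
        have h1 := (hbr n (G.src b) (G.tgt b) hsn htn (hs.trans ht) fun c h₁ h₂ =>
          hn ▸ hG.dim_le_of_src_lt_of_lt_tgt h0 h₁ h₂).1 b hn hs ht
        have h2 : sepLe H n (f (G.src b)) (f (G.tgt b)) := by
          cases n with
          | zero => exact hmono _ _ hsn htn (hs.trans ht).le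
          | succ k =>
            have hss := hG.src_src (x := b) (by omega)
            have hts := hG.tgt_src (x := b) (by omega)
            have p1 : 0 < G.dim (G.src b) := by omega
            have p2 : 0 < G.dim (G.tgt b) := by omega
            have q1 := hG.dim_src p1
            have q2 := hG.dim_tgt p1
            refine (hbr k (G.src (G.src b)) (G.tgt (G.src b)) (by omega) (by omega)
              ((GlobData.src_lt p1).trans (GlobData.lt_tgt p1)) fun c h₁ h₂ =>
              hsn ▸ hG.dim_le_of_src_lt_of_lt_tgt p1 h₁ h₂).2 _ _ hsn (GlobData.src_lt p1)
              (GlobData.lt_tgt p1) htn ?_ ?_ (hs.trans ht).le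
            · rw [hss]
              exact GlobData.src_lt p2
            · rw [hts]
              exact GlobData.lt_tgt p2
        exact (sum_d_smul_chainOf f h0).trans (h1.bnd_eq hH
          (fun x hx => (hdf _ x hx).trans hsn) (fun x hx => (hdf _ x hx).trans htn) h2)
    · classical
      exact (Int.natCast_nonneg _).trans_eq (chainOf_apply (f b) a).symm
    · rw [aug_chainOf fun x hx => (hdf b x hx).trans hb, hlen b hb]
      rfl
end

section
/- Let K^1, …, K^m be augmented directed complexes with bases. Then V(m,K) has a basis, consisting of the 0-dimensional elements p^0, …, p^m together with the images under s of the basis elements of the K^i. Moreover, if the bases of the K^i are all unital, then this basis of V(m,K) is unital. -/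
/-- The wreath-product construction `V(m, K)` on augmented directed complexes with
bases: basis elements are the points `p^0, …, p^m` (in dimension `0`) together with
the suspended basis elements `s b` for `b` a basis element of some `K^i` (with
`|s b| = |b| + 1`); `∂(s x) = s(∂ x)` in positive degrees,
`∂(s x) = (ε x)(p^{i} - p^{i-1})` in degree `0`, `∂ p^i = 0` and `ε p^i = 1`. -/
noncomputable def Vdata (m : ℕ) (K : Fin m → PreADC) : PreADC where
  B := Fin (m + 1) ⊕ (Σ i : Fin m, (K i).B)
  dim := fun x =>
    match x with
    | Sum.inl _ => 0
    | Sum.inr ⟨i, b⟩ => (K i).dim b + 1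
  d := fun x =>
    match x with
    | Sum.inl _ => 0
    | Sum.inr ⟨i, b⟩ =>
        if 0 < (K i).dim b then
          Finsupp.mapDomain (fun a => Sum.inr ⟨i, a⟩) ((K i).d b)
        else
          (K i).eps b •
            (Finsupp.single (Sum.inl i.succ) 1 - Finsupp.single (Sum.inl i.castSucc) 1)
  eps := fun x =>
    match x with
    | Sum.inl _ => 1
    | Sum.inr _ => 0

namespace PreADC

/-- A chain all of whose terms have dimension `n`. -/
def Homogeneous (K : PreADC) (n : ℕ) (x : K.B →₀ ℤ) : Prop :=
  ∀ a, x a ≠ 0 → K.dim a = n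

theorem Homogeneous.single (K : PreADC) (b : K.B) :
    K.Homogeneous (K.dim b) (Finsupp.single b 1) := by
  classical
  intro a ha
  rw [Finsupp.single_apply] at ha
  split_ifs at ha with h
  · rw [h]
  · exact absurd rfl ha

theorem Homogeneous.mapRange {K : PreADC} {n : ℕ} {x : K.B →₀ ℤ} (hx : K.Homogeneous n x)
    (f : ℤ → ℤ) (hf : f 0 = 0) : K.Homogeneous n (Finsupp.mapRange f hf x) := by
  intro a ha
  refine hx a fun h => ha ?_
  rw [Finsupp.mapRange_apply, h, hf]

theorem Homogeneous.bnd {K : PreADC} (hK : K.IsADC) {n : ℕ} {x : K.B →₀ ℤ}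
    (hx : K.Homogeneous (n + 1) x) : K.Homogeneous n (K.bnd x) := by
  intro a ha
  rw [PreADC.bnd, Finsupp.sum_apply, Finsupp.sum] at ha
  obtain ⟨b, hb, hba⟩ := Finset.exists_ne_zero_of_sum_ne_zero ha
  have hdim := hx b (Finsupp.mem_support_iff.mp hb)
  have hd := hK.2.1 b a fun h => hba (by simp [h])
  omega

theorem aug_sub (K : PreADC) (x y : K.B →₀ ℤ) : K.aug (x - y) = K.aug x - K.aug y := by
  refine Finsupp.sum_sub_index fun a c d => ?_
  split_ifs <;> ring

theorem aug_smul (K : PreADC) (c : ℤ) (x : K.B →₀ ℤ) : K.aug (c • x) = c * K.aug x := by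
  rw [aug, aug, Finsupp.sum_smul_index (by simp), Finsupp.mul_sum]
  refine Finsupp.sum_congr fun a _ => ?_
  split_ifs <;> ring

end PreADC

namespace Vdata

open PreADC

variable {m : ℕ} (K : Fin m → PreADC)

/-- The vertex `p^j` of `V(m, K)`, as a basis element. -/
def vertex (j : Fin (m + 1)) : (Vdata m K).B := Sum.inl j

/-- The suspension `s b` of a basis element `b` of `K^i`, as a basis element of `V(m, K)`. -/
def susp (i : Fin m) (b : (K i).B) : (Vdata m K).B := Sum.inr ⟨i, b⟩

theorem susp_injective (i : Fin m) : Function.Injective (susp K i) := by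
  intro a b h
  exact eq_of_heq (Sigma.mk.inj (Sum.inr.inj h)).2

/-- The difference `p^i - p^{i-1}` of the two endpoints of the `i`-th suspension. -/
noncomputable def endpoints (i : Fin m) : (Vdata m K).B →₀ ℤ :=
  Finsupp.single (vertex K i.succ) 1 - Finsupp.single (vertex K i.castSucc) 1

theorem endpoints_susp (i k : Fin m) (b : (K k).B) : endpoints K i (susp K k b) = 0 := by
  rw [endpoints, Finsupp.sub_apply, Finsupp.single_eq_of_ne, Finsupp.single_eq_of_ne, sub_zero]
  all_goals exact Sum.inr_ne_inl

theorem d_susp_of_pos {i : Fin m} {b : (K i).B} (h : 0 < (K i).dim b) :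
    (Vdata m K).d (susp K i b) = Finsupp.mapDomain (susp K i) ((K i).d b) :=
  if_pos h

theorem d_susp_of_dim_eq_zero {i : Fin m} {b : (K i).B} (h : (K i).dim b = 0) :
    (Vdata m K).d (susp K i b) = (K i).eps b • endpoints K i :=
  if_neg (by omega)

theorem dim_susp (i : Fin m) (b : (K i).B) :
    (Vdata m K).dim (susp K i b) = (K i).dim b + 1 := rfl

theorem aug_single_vertex (j : Fin (m + 1)) :
    (Vdata m K).aug (Finsupp.single (vertex K j) 1) = 1 := by
  rw [aug, Finsupp.sum_single_index (by simp)]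
  rfl

theorem aug_endpoints (i : Fin m) : (Vdata m K).aug (endpoints K i) = 0 := by
  rw [endpoints, aug_sub, aug_single_vertex, aug_single_vertex, sub_self]

theorem bnd_mapDomain_susp (i : Fin m) (x : (K i).B →₀ ℤ) :
    (Vdata m K).bnd (Finsupp.mapDomain (susp K i) x) =
      x.sum fun b c => c • (Vdata m K).d (susp K i b) :=
  Finsupp.sum_mapDomain_index (fun _ => zero_smul _ _) fun _ _ _ => add_smul _ _ _

theorem bnd_mapDomain_susp_of_pos {i : Fin m} {n : ℕ} {x : (K i).B →₀ ℤ}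
    (hx : (K i).Homogeneous (n + 1) x) :
    (Vdata m K).bnd (Finsupp.mapDomain (susp K i) x) =
      Finsupp.mapDomain (susp K i) ((K i).bnd x) := by
  rw [bnd_mapDomain_susp, bnd, Finsupp.sum, Finsupp.sum, Finsupp.mapDomain_finsetSum]
  refine Finset.sum_congr rfl fun b hb => ?_
  have hdim := hx b (Finsupp.mem_support_iff.mp hb)
  rw [d_susp_of_pos K (by omega), Finsupp.mapDomain_smul]

theorem bnd_mapDomain_susp_of_zero {i : Fin m} {x : (K i).B →₀ ℤ}
    (hx : (K i).Homogeneous 0 x) :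
    (Vdata m K).bnd (Finsupp.mapDomain (susp K i) x) = (K i).aug x • endpoints K i := by
  rw [bnd_mapDomain_susp, aug, Finsupp.sum, Finsupp.sum, Finset.sum_smul]
  refine Finset.sum_congr rfl fun b hb => ?_
  have hdim := hx b (Finsupp.mem_support_iff.mp hb)
  rw [d_susp_of_dim_eq_zero K hdim, if_pos hdim, smul_smul]

theorem bnd_endpoints (i : Fin m) : (Vdata m K).bnd (endpoints K i) = 0 := by
  have h : ∀ j, (Vdata m K).d (vertex K j) = 0 := fun _ => rfl
  rw [endpoints, bnd, Finsupp.sum_sub_index fun _ _ _ => sub_smul _ _ _]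
  simp [h]

theorem bnd_smul_endpoints (i : Fin m) (c : ℤ) :
    (Vdata m K).bnd (c • endpoints K i) = 0 := by
  have h : (Vdata m K).bnd (c • endpoints K i) = c • (Vdata m K).bnd (endpoints K i) :=
    (Finsupp.linearCombination ℤ (Vdata m K).d).map_smul c _
  rw [h, bnd_endpoints, smul_zero]

theorem isADC (hK : ∀ i, (K i).IsADC) : (Vdata m K).IsADC := by
  classical
  refine ⟨?_, ?_, ?_, ?_⟩
  · rintro (j | ⟨i, b⟩) h
    · rfl
    · exact absurd h (Nat.succ_ne_zero _)
  · rintro (j | ⟨i, b⟩) a ha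
    · exact absurd rfl ha
    change (Vdata m K).d (susp K i b) a ≠ 0 at ha
    change _ = (K i).dim b + 1
    rcases Nat.eq_zero_or_pos ((K i).dim b) with h | h
    · rw [d_susp_of_dim_eq_zero K h] at ha
      rcases a with j | ⟨k, a⟩
      · rw [h]
        rfl
      · refine absurd ?_ ha
        change (K i).eps b * endpoints K i (susp K k a) = 0
        rw [endpoints_susp, mul_zero]
    · rw [d_susp_of_pos K h] at ha
      by_cases hr : a ∈ Set.range (susp K i)
      · obtain ⟨a, rfl⟩ := hr
        rw [Finsupp.mapDomain_apply (susp_injective K i)] at ha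
        rw [dim_susp, (hK i).2.1 b a ha]
      · exact absurd (Finsupp.mapDomain_of_notMem_range _ _ hr) ha
  · rintro (j | ⟨i, b⟩)
    · exact Finsupp.sum_zero_index
    change (Vdata m K).bnd ((Vdata m K).d (susp K i b)) = 0
    rcases hn : (K i).dim b with _ | _ | n
    · rw [d_susp_of_dim_eq_zero K hn, bnd_smul_endpoints]
    · rw [d_susp_of_pos K (by omega), bnd_mapDomain_susp_of_zero K, (hK i).2.2.2 b hn, zero_smul]
      intro a ha
      have := (hK i).2.1 b a ha
      omega
    · rw [d_susp_of_pos K (by omega), bnd_mapDomain_susp_of_pos K (n := n), (hK i).2.2.1 b,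
        Finsupp.mapDomain_zero]
      intro a ha
      have := (hK i).2.1 b a ha
      omega
  · rintro (j | ⟨i, b⟩) h
    · exact absurd h Nat.zero_ne_one
    change (Vdata m K).aug ((Vdata m K).d (susp K i b)) = 0
    rw [d_susp_of_dim_eq_zero K (Nat.succ.inj h), aug_smul, aug_endpoints, mul_zero]

theorem mapRange_mapDomain_susp (i : Fin m) (f : ℤ → ℤ) (hf : f 0 = 0) (x : (K i).B →₀ ℤ) :
    Finsupp.mapRange f hf (Finsupp.mapDomain (susp K i) x) =
      Finsupp.mapDomain (susp K i) (Finsupp.mapRange f hf x) := by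
  ext a
  rw [Finsupp.mapRange_apply]
  by_cases hr : a ∈ Set.range (susp K i)
  · obtain ⟨a, rfl⟩ := hr
    rw [Finsupp.mapDomain_apply (susp_injective K i),
      Finsupp.mapDomain_apply (susp_injective K i), Finsupp.mapRange_apply]
  · rw [Finsupp.mapDomain_of_notMem_range _ _ hr, Finsupp.mapDomain_of_notMem_range _ _ hr, hf]

/-- Iterating the composite of the boundary with a coefficientwise operation, such as `∂⁻` or
`∂⁺`, commutes with suspension as long as the dimension stays positive. -/
theorem iterate_mapRange_bnd_susp {i : Fin m} (hK : (K i).IsADC) (f : ℤ → ℤ) (hf : f 0 = 0)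
    (n : ℕ) {x : (K i).B →₀ ℤ} (hx : (K i).Homogeneous n x) :
    (fun y => Finsupp.mapRange f hf ((Vdata m K).bnd y))^[n] (Finsupp.mapDomain (susp K i) x) =
        Finsupp.mapDomain (susp K i)
          ((fun y => Finsupp.mapRange f hf ((K i).bnd y))^[n] x) ∧
      (K i).Homogeneous 0 ((fun y => Finsupp.mapRange f hf ((K i).bnd y))^[n] x) := by
  induction n generalizing x with
  | zero => exact ⟨rfl, hx⟩
  | succ n ih =>
    rw [Function.iterate_succ_apply, Function.iterate_succ_apply,
      bnd_mapDomain_susp_of_pos K hx, mapRange_mapDomain_susp]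
    exact ih ((hx.bnd hK).mapRange f hf)

theorem aug_iterate_mapRange_bnd_susp {i : Fin m} (hK : (K i).IsADC) (f : ℤ → ℤ) (hf : f 0 = 0)
    {b : (K i).B} {j : Fin (m + 1)}
    (hj : Finsupp.mapRange f hf (endpoints K i) = Finsupp.single (vertex K j) 1)
    (hb : (K i).aug ((fun y => Finsupp.mapRange f hf ((K i).bnd y))^[(K i).dim b]
      (Finsupp.single b 1)) = 1) :
    (Vdata m K).aug ((fun y => Finsupp.mapRange f hf ((Vdata m K).bnd y))^[(K i).dim b + 1]
      (Finsupp.single (susp K i b) 1)) = 1 := by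
  obtain ⟨h, h₀⟩ := iterate_mapRange_bnd_susp K hK f hf _ (Homogeneous.single (K i) b)
  rw [Finsupp.mapDomain_single] at h
  rw [Function.iterate_succ_apply', h, bnd_mapDomain_susp_of_zero K h₀, hb, one_smul, hj,
    aug_single_vertex]

theorem vertex_castSucc_ne_succ (i : Fin m) : vertex K i.castSucc ≠ vertex K i.succ :=
  fun h => (Fin.castSucc_lt_succ (i := i)).ne (Sum.inl.inj h)

theorem posPart_endpoints (i : Fin m) :
    PreADC.posPart (endpoints K i) = Finsupp.single (vertex K i.succ) 1 := by
  classical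
  ext a
  have h := vertex_castSucc_ne_succ K i
  simp only [PreADC.posPart, endpoints, Finsupp.mapRange_apply, Finsupp.sub_apply, Finsupp.single_apply]
  split_ifs <;> simp_all

theorem negPart_endpoints (i : Fin m) :
    PreADC.negPart (endpoints K i) = Finsupp.single (vertex K i.castSucc) 1 := by
  classical
  ext a
  have h := vertex_castSucc_ne_succ K i
  simp only [PreADC.negPart, endpoints, Finsupp.mapRange_apply, Finsupp.sub_apply, Finsupp.single_apply]
  split_ifs <;> simp_all

theorem unital (hK : ∀ i, (K i).IsADC) (hU : ∀ i, (K i).Unital) : (Vdata m K).Unital := by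
  rintro (j | ⟨i, b⟩)
  · exact ⟨aug_single_vertex K j, aug_single_vertex K j⟩
  · exact ⟨aug_iterate_mapRange_bnd_susp K (hK i) (fun c => max (-c) 0) (by simp)
        (negPart_endpoints K i) (hU i b).1,
      aug_iterate_mapRange_bnd_susp K (hK i) (fun c => max c 0) (by simp)
        (posPart_endpoints K i) (hU i b).2⟩

end Vdata

/-- If `K^1, …, K^m` are augmented directed complexes with bases, then `V(m, K)` is
an augmented directed complex with basis consisting of the `p^i` together with the
suspended basis elements; moreover if the bases of the `K^i` are unital then so is
the basis of `V(m, K)`. -/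
theorem stmt13 (m : ℕ) (K : Fin m → PreADC) (hK : ∀ i, PreADC.IsADC (K i)) :
    PreADC.IsADC (Vdata m K) ∧
    ((∀ i, PreADC.Unital (K i)) → PreADC.Unital (Vdata m K)) := by
  exact ⟨Vdata.isADC K hK, Vdata.unital K hK⟩
end

section
/- Let K and L be augmented directed complexes with bases such that the basis of L is loop-free and unital. If f : K → L is a chain map taking sums of basis elements to sums of basis elements (i.e., f(K_q*) ⊆ L_q* for all q) and satisfying ε ∘ f = 0 on K_0, then f = 0. -/
namespace PreADC

theorem dMinus_single (L : PreADC) (b : L.B) :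
    L.dMinus (Finsupp.single b 1) = negPart (L.d b) := by
  simp [dMinus, bnd]

theorem dPlus_single (L : PreADC) (b : L.B) :
    L.dPlus (Finsupp.single b 1) = posPart (L.d b) := by
  simp [dPlus, bnd]

theorem dMinus_zero (L : PreADC) : L.dMinus 0 = 0 := by
  ext a
  simp [dMinus, bnd, negPart]

theorem bnd_apply (L : PreADC) (c : L.B →₀ ℤ) (a : L.B) :
    L.bnd c a = ∑ b ∈ c.support, c b * L.d b a := by
  simp [bnd, Finsupp.sum]

/-- A basis element of positive dimension in a unital basis has nonzero negative boundary. -/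
theorem Unital.negPart_d_ne_zero {L : PreADC} (hL : L.Unital) {b : L.B} (hb : L.dim b ≠ 0) :
    negPart (L.d b) ≠ 0 := by
  intro h
  obtain ⟨n, hn⟩ := Nat.exists_eq_succ_of_ne_zero hb
  have h1 := (hL b).1
  rw [hn, Function.iterate_succ_apply, dMinus_single, h,
    Function.iterate_fixed L.dMinus_zero] at h1
  simp [aug] at h1

/-- In a unital basis, a nonnegative chain of dimension zero and augmentation zero vanishes. -/
theorem Unital.eq_zero_of_aug_eq_zero {L : PreADC} (hL : L.Unital) {c : L.B →₀ ℤ}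
    (hdim : ∀ a, c a ≠ 0 → L.dim a = 0) (hc : ∀ a, 0 ≤ c a) (h : L.aug c = 0) : c = 0 := by
  have heps : ∀ a, L.dim a = 0 → L.eps a = 1 := fun a ha => by
    simpa [ha, aug] using (hL a).1
  have hsum : ∑ a ∈ c.support, c a = 0 := by
    rw [← h]
    refine Finset.sum_congr rfl fun a ha => ?_
    have h0 := hdim a (Finsupp.mem_support_iff.mp ha)
    simp [h0, heps a h0]
  ext a
  by_contra ha
  exact ha ((Finset.sum_eq_zero_iff_of_nonneg fun a _ => hc a).mp hsum a
    (Finsupp.mem_support_iff.mpr ha))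

/-- In a loop-free unital basis, a nonnegative cycle of positive dimension vanishes. -/
theorem LoopFree.eq_zero_of_bnd_eq_zero {L : PreADC} (hl : L.LoopFree) (hu : L.Unital)
    {c : L.B →₀ ℤ} {q : ℕ} (hdim : ∀ a, c a ≠ 0 → L.dim a = q + 1) (hc : ∀ a, 0 ≤ c a)
    (h : L.bnd c = 0) : c = 0 := by
  obtain ⟨r, htrans, hirr, hneg, hpos⟩ := hl q
  by_contra hne
  have : IsStrictOrder L.B r := { irrefl := hirr, trans := htrans }
  obtain ⟨⟨b, hb⟩, -, hmin⟩ := WellFounded.has_min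
    (c.support.finite_toSet.wellFoundedOn (r := r)) Set.univ
    (by
      obtain ⟨b, hb⟩ := Finsupp.support_nonempty_iff.mpr hne
      exact ⟨⟨b, hb⟩, trivial⟩)
  have hb0 : c b ≠ 0 := Finsupp.mem_support_iff.mp hb
  have hbd := hdim b hb0
  obtain ⟨a, ha⟩ := Finsupp.ne_iff.mp (hu.negPart_d_ne_zero (b := b) (by omega))
  have hab : r a b := hneg a b (by omega) (by
    rw [hbd, Nat.add_sub_cancel_left]
    simpa [dMinus_single] using ha)
  have hda : L.d b a < 0 := by
    by_contra hd
    exact ha (by simpa [negPart] using hd)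
  have hex : ∃ b' ∈ c.support, 0 < c b' * L.d b' a := by
    by_contra! hall
    have hlt := Finset.sum_lt_sum hall
      ⟨b, hb, mul_neg_of_pos_of_neg (lt_of_le_of_ne (hc b) hb0.symm) hda⟩
    rw [← bnd_apply, h] at hlt
    simp at hlt
  obtain ⟨b', hb', hprod⟩ := hex
  have hda' : 0 < L.d b' a := pos_of_mul_pos_right hprod (hc b')
  have hbd' := hdim b' (Finsupp.mem_support_iff.mp hb')
  have hb'a : r b' a := hpos b' a (by omega) (by
    rw [hbd', Nat.add_sub_cancel_left]
    simpa [dPlus_single, posPart] using hda')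
  exact hmin ⟨b', hb'⟩ trivial (htrans _ _ _ hb'a hab)

end PreADC

/-- If `L` has a loop-free unital basis and `f : K → L` is a chain map taking sums of
basis elements to sums of basis elements with `ε ∘ f = 0` on `K_0`, then `f = 0`. -/
theorem stmt16 (K L : PreADC) (hK : PreADC.IsADC K) (hL : PreADC.IsADC L)
    (hLl : PreADC.LoopFree L) (hLu : PreADC.Unital L)
    (f : K.B → (L.B →₀ ℤ)) (hf : PreADC.IsMor K L f)
    (haug : ∀ b, K.dim b = 0 → L.aug (f b) = 0) :
    ∀ b, f b = 0 := by
  obtain ⟨hdim, hchain, hnonneg⟩ := hf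
  have key : ∀ n b, K.dim b = n → f b = 0 := by
    intro n
    induction n with
    | zero =>
      intro b hb
      exact hLu.eq_zero_of_aug_eq_zero (fun a ha => (hdim b a ha).trans hb) (hnonneg b)
        (haug b hb)
    | succ n ih =>
      intro b hb
      refine hLl.eq_zero_of_bnd_eq_zero hLu (fun a ha => (hdim b a ha).trans hb) (hnonneg b) ?_
      rw [← hchain b]
      refine Finset.sum_eq_zero fun a ha => ?_
      have had := hK.2.1 b a (Finsupp.mem_support_iff.mp ha)
      simp [ih a (by omega)]
  exact fun b => key _ b rfl
end

section
/- Let K^1, …, K^m and L^1, …, L^n be non-zero augmented directed complexes with loop-free unital bases. Then the assignment (φ, f) ↦ V(φ, f) is a bijection from the set of wreath-product morphisms from (m, K) to (n, L) onto the set of morphisms of augmented directed complexes V(m,K) → V(n,L). (Equivalently, the functor V : Δ≀Φ → Φ is fully faithful, where Φ is the full subcategory of augmented directed complexes consisting of the non-zero augmented directed complexes with loop-free unital bases.) -/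
/-- `j` lies in the range `φ(i-1) < j ≤ φ(i)` (with our zero-indexed blocks:
`φ(i) ≤ j` and `j + 1 ≤ φ(i+1)`). -/
def InRange {m n : ℕ} (φ : Fin (m + 1) → Fin (n + 1)) (i : Fin m) (j : Fin n) : Prop :=
  φ i.castSucc ≤ j.castSucc ∧ j.succ ≤ φ i.succ

instance {m n : ℕ} (φ : Fin (m + 1) → Fin (n + 1)) (i : Fin m) (j : Fin n) :
    Decidable (InRange φ i j) :=
  inferInstanceAs (Decidable (φ i.castSucc ≤ j.castSucc ∧ j.succ ≤ φ i.succ))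

/-- A morphism `(φ, f) : (m, K) → (n, L)` in the wreath product `Δ ≀ adc`:
a monotone `φ` and a family of morphisms of augmented directed complexes
`f_i^j : K^i → L^j` for `j` in range (we normalise `f i j` to be zero out of range). -/
structure WreathMor (m n : ℕ) (K : Fin m → PreADC) (L : Fin n → PreADC) where
  φ : Fin (m + 1) → Fin (n + 1)
  mono : Monotone φ
  f : ∀ (i : Fin m) (j : Fin n), (K i).B → ((L j).B →₀ ℤ)
  f_zero : ∀ i j, ¬ InRange φ i j → f i j = fun _ => 0
  f_mor : ∀ i j, InRange φ i j → PreADC.IsAugMor (K i) (L j) (f i j)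

/-- The morphism `V(φ, f) : V(m, K) → V(n, L)`: `p^i ↦ p^{φ(i)}` and
`s x ↦ Σ_{φ(i-1) < j ≤ φ(i)} s (f_i^j x)`. -/
noncomputable def Vmor (m n : ℕ) (K : Fin m → PreADC) (L : Fin n → PreADC)
    (φ : Fin (m + 1) → Fin (n + 1))
    (f : ∀ (i : Fin m) (j : Fin n), (K i).B → ((L j).B →₀ ℤ)) :
    (Vdata m K).B → ((Vdata n L).B →₀ ℤ) :=
  fun x =>
    match x with
    | Sum.inl i => Finsupp.single (Sum.inl (φ i)) 1
    | Sum.inr ⟨i, b⟩ =>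
        ∑ j : Fin n,
          if InRange φ i j then
            Finsupp.mapDomain (fun a => Sum.inr ⟨j, a⟩) (f i j b)
          else 0

open Finsupp

namespace PreADC

theorem bnd_eq_linearCombination (K : PreADC) (x : K.B →₀ ℤ) :
    K.bnd x = linearCombination ℤ K.d x := rfl

theorem aug_eq_linearCombination (K : PreADC) (x : K.B →₀ ℤ) :
    K.aug x = linearCombination ℤ (fun a => if K.dim a = 0 then K.eps a else 0) x := by
  rw [linearCombination_apply, aug]
  exact Finsupp.sum_congr fun a _ => by split_ifs <;> simp

theorem bnd_zero (K : PreADC) : K.bnd 0 = 0 := by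
  simp [bnd_eq_linearCombination]

theorem aug_zero (K : PreADC) : K.aug 0 = 0 := by
  simp [aug_eq_linearCombination]

theorem bnd_single (K : PreADC) (b : K.B) : K.bnd (single b 1) = K.d b := by
  simp [bnd_eq_linearCombination]

theorem dPlus_zero (K : PreADC) : K.dPlus 0 = 0 := by
  simp [dPlus, bnd_zero, posPart]

theorem dMinus_apply (K : PreADC) (x : K.B →₀ ℤ) (a : K.B) :
    K.dMinus x a = max (-(K.bnd x a)) 0 := rfl

theorem dPlus_apply (K : PreADC) (x : K.B →₀ ℤ) (a : K.B) :
    K.dPlus x a = max (K.bnd x a) 0 := rfl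

theorem bnd_eq_zero_of_dim_eq_zero {K : PreADC} (hK : K.IsADC) {x : K.B →₀ ℤ}
    (hx : ∀ a, x a ≠ 0 → K.dim a = 0) : K.bnd x = 0 := by
  rw [bnd]
  exact Finset.sum_eq_zero fun a ha => by
    simp [hK.1 a (hx a (mem_support_iff.1 ha))]

theorem aug_eq_zero_of_dim_ne_zero {K : PreADC} {x : K.B →₀ ℤ}
    (hx : ∀ a, x a ≠ 0 → K.dim a ≠ 0) : K.aug x = 0 := by
  rw [aug]
  exact Finset.sum_eq_zero fun a ha => by
    simp [hx a (mem_support_iff.1 ha)]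

theorem Unital.eps_eq_one {K : PreADC} (hu : K.Unital) {b : K.B} (hb : K.dim b = 0) :
    K.eps b = 1 := by
  have h := (hu b).1
  rw [hb] at h
  simpa [aug_eq_linearCombination, hb] using h

theorem Unital.exists_dim_eq_zero {K : PreADC} (hu : K.Unital) [hne : Nonempty K.B] :
    ∃ b, K.dim b = 0 := by
  obtain ⟨b⟩ := hne
  by_contra! h
  have h1 := (hu b).1
  rw [aug_eq_zero_of_dim_ne_zero fun a _ => h a] at h1
  exact zero_ne_one h1

theorem Unital.dPlus_single_ne_zero {K : PreADC} (hu : K.Unital) {b : K.B}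
    (hb : K.dim b ≠ 0) : K.dPlus (single b 1) ≠ 0 := by
  intro h
  obtain ⟨k, hk⟩ := Nat.exists_eq_succ_of_ne_zero hb
  have h1 := (hu b).2
  rw [hk, Function.iterate_succ_apply, h, Function.iterate_fixed K.dPlus_zero, aug_zero] at h1
  exact zero_ne_one h1

/-- In dimension zero, a nonnegative chain of augmentation zero vanishes. -/
theorem Unital.eq_zero_of_aug_eq_zero_s17 {K : PreADC} (hu : K.Unital) {x : K.B →₀ ℤ}
    (hx : ∀ a, 0 ≤ x a) (hd : ∀ a, x a ≠ 0 → K.dim a = 0) (h : K.aug x = 0) : x = 0 := by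
  have h1 : ∑ a ∈ x.support, x a = 0 := by
    rw [← h, aug, Finsupp.sum]
    refine Finset.sum_congr rfl fun a ha => ?_
    have := hd a (mem_support_iff.1 ha)
    simp [this, hu.eps_eq_one this]
  rw [Finset.sum_eq_zero_iff_of_nonneg fun a _ => hx a] at h1
  ext a
  by_contra ha
  exact ha (h1 a (mem_support_iff.2 ha))

theorem Unital.aug_nonneg {K : PreADC} (hu : K.Unital) {x : K.B →₀ ℤ}
    (hx : ∀ a, 0 ≤ x a) : 0 ≤ K.aug x := by
  refine Finset.sum_nonneg fun a _ => ?_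
  dsimp only
  split_ifs with h
  · simpa [hu.eps_eq_one h] using hx a
  · exact le_rfl

/-- In a complex with a loop-free unital basis, a nonnegative homogeneous cycle of positive
dimension vanishes. -/
theorem LoopFree.eq_zero_of_bnd_eq_zero_s17 {K : PreADC} (hl : K.LoopFree) (hu : K.Unital)
    {x : K.B →₀ ℤ} {q : ℕ} (hx : ∀ a, 0 ≤ x a) (hd : ∀ a, x a ≠ 0 → K.dim a = q + 1)
    (h : K.bnd x = 0) : x = 0 := by
  by_contra hne
  obtain ⟨r, htrans, hirr, hminus, hplus⟩ := hl q
  have : IsStrictOrder K.B r := { trans := htrans, irrefl := hirr }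
  obtain ⟨b, hb, hmax⟩ : ∃ b ∈ x.support, ∀ b' ∈ x.support, ¬ r b b' := by
    let : PartialOrder K.B := partialOrderOfSO r
    obtain ⟨b, hb⟩ := x.support.exists_maximal (support_nonempty_iff.2 hne)
    exact ⟨b, hb.1, fun b' hb' hr => hb.not_gt hb' hr⟩
  have hdb := hd b (mem_support_iff.1 hb)
  obtain ⟨a, ha⟩ : ∃ a, K.dPlus (single b 1) a ≠ 0 :=
    Finsupp.ne_iff.1 (hu.dPlus_single_ne_zero (by omega))
  have hba : r b a := hplus b a (by omega) (by simpa [hdb] using ha)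
  have hpos : 0 < K.d b a := by
    rw [dPlus_apply, bnd_single] at ha
    by_contra! hle
    exact ha (max_eq_right hle)
  have hsum : ∑ c ∈ x.support, x c * K.d c a = 0 := by
    have := DFunLike.congr_fun h a
    simpa [bnd, Finsupp.sum, finsetSum_apply] using this
  obtain ⟨b', hb', hneg⟩ : ∃ b' ∈ x.support, x b' * K.d b' a < 0 := by
    by_contra! hall
    have := (Finset.sum_eq_zero_iff_of_nonneg hall).1 hsum b hb
    have hxb := mem_support_iff.1 hb
    rcases mul_eq_zero.1 this with h | h
    · exact hxb h
    · exact hpos.ne' h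
  have hneg' : K.d b' a < 0 := by
    by_contra! hge
    exact hneg.not_ge (mul_nonneg (hx b') hge)
  have hdb' := hd b' (mem_support_iff.1 hb')
  have hab' : r a b' := hminus a b' (by omega) (by
    rw [hdb', Nat.add_sub_cancel_left, Function.iterate_one, dMinus_apply, bnd_single]
    have := le_max_left (-(K.d b' a)) 0
    omega)
  exact hmax b' hb' (htrans _ _ _ hba hab')

/-- A nonnegative chain map into a complex with a loop-free unital basis vanishes as soon as it
vanishes in dimension zero. -/
theorem IsMor.eq_zero {K L : PreADC} {f : K.B → (L.B →₀ ℤ)} (hf : IsMor K L f)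
    (hK : K.IsADC) (hl : L.LoopFree) (hu : L.Unital)
    (h0 : ∀ b, K.dim b = 0 → f b = 0) (b : K.B) : f b = 0 := by
  induction hq : K.dim b generalizing b with
  | zero => exact h0 b hq
  | succ q ih =>
    refine hl.eq_zero_of_bnd_eq_zero_s17 hu (q := q) (hf.2.2 b)
      (fun a ha => (hf.1 b a ha).trans hq) ?_
    rw [← hf.2.1 b]
    refine Finset.sum_eq_zero fun a ha => ?_
    have := hK.2.1 b a (mem_support_iff.1 ha)
    simp [ih a (by omega)]

end PreADC

theorem Fin.sum_mul_succ_sub_castSucc_iff {n : ℕ} (c : Fin n → ℤ) (u v : Fin (n + 1)) :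
    (∀ k, ∑ j, c j * ((if j.succ = k then 1 else 0) - (if j.castSucc = k then 1 else 0)) =
      (if v = k then 1 else 0) - (if u = k then 1 else 0)) ↔
    ∀ j, c j = (if j.succ ≤ v then 1 else 0) - (if j.succ ≤ u then 1 else 0) := by
  constructor
  · intro h j
    have hk : ∑ k, (if j.succ ≤ k then (1 : ℤ) else 0) *
          ∑ i, c i * ((if i.succ = k then 1 else 0) - (if i.castSucc = k then 1 else 0)) =
        ∑ k, (if j.succ ≤ k then (1 : ℤ) else 0) *
          ((if v = k then 1 else 0) - (if u = k then 1 else 0)) :=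
      Finset.sum_congr rfl fun k _ => by rw [h k]
    simp only [Finset.mul_sum] at hk
    rw [Finset.sum_comm] at hk
    simp only [mul_sub, Finset.sum_sub_distrib,
      mul_ite, mul_one, mul_zero, Finset.sum_ite_eq, Finset.mem_univ, if_true] at hk
    rw [← hk, ← Finset.sum_sub_distrib, Finset.sum_eq_single j]
    · simp
    · intro i _ hij
      have : j.succ ≤ i.succ ↔ j.succ ≤ i.castSucc := by
        simp only [Fin.le_def, Fin.val_succ, Fin.val_castSucc]
        have := Fin.val_ne_of_ne hij
        omega
      simp [-Fin.succ_le_succ_iff, this]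
    · simp
  · intro h k
    have key : ∀ w : Fin (n + 1), ∑ j : Fin n, (if j.succ ≤ w then (1 : ℤ) else 0) *
        ((if j.succ = k then 1 else 0) - (if j.castSucc = k then 1 else 0)) =
        (if w = k then 1 else 0) - (if 0 = k then 1 else 0) := by
      intro w
      induction w using Fin.induction with
      | zero => simp
      | succ w ih =>
        have : ∀ j : Fin n, (if j.succ ≤ w.succ then (1 : ℤ) else 0) =
            (if j.succ ≤ w.castSucc then 1 else 0) + if w = j then 1 else 0 := by
          intro j
          simp only [Fin.le_def, Fin.ext_iff, Fin.val_succ, Fin.val_castSucc]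
          split_ifs <;> omega
        simp only [this, add_mul, Finset.sum_add_distrib, ih]
        simp
    simp only [h, sub_mul, Finset.sum_sub_distrib, key]
    ring

theorem Finset.exists_eq_ite_of_sum_eq_one {α : Type*} [Fintype α] [DecidableEq α] {x : α → ℤ}
    (hx : ∀ a, 0 ≤ x a) (h : ∑ a, x a = 1) : ∃ k, ∀ a, x a = if k = a then 1 else 0 := by
  obtain ⟨k, -, hk⟩ := Finset.exists_ne_zero_of_sum_ne_zero (h.trans_ne one_ne_zero)
  refine ⟨k, fun a => ?_⟩
  have hpos : 1 ≤ x k := lt_of_le_of_ne (hx k) hk.symm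
  split_ifs with hka
  · subst hka
    have := Finset.single_le_sum (fun a _ => hx a) (Finset.mem_univ k)
    omega
  · have := Finset.add_le_sum (fun a _ => hx a) (Finset.mem_univ k) (Finset.mem_univ a) hka
    have := hx a
    omega

section Vdata

variable {n : ℕ} (L : Fin n → PreADC)

/-- The inclusion of the basis of `L^j` in the basis of `V(n, L)` by suspension. -/
def Vsusp (j : Fin n) (a : (L j).B) : (Vdata n L).B := Sum.inr ⟨j, a⟩

/-- The point `p^k` of `V(n, L)`. -/
def Vpoint (k : Fin (n + 1)) : (Vdata n L).B := Sum.inl k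

theorem Vsusp_injective (j : Fin n) : Function.Injective (Vsusp L j) := fun _ _ h =>
  eq_of_heq (Sigma.mk.inj (Sum.inr_injective h)).2

/-- The desuspended component in `L^j` of a chain in `V(n, L)`. -/
noncomputable def Vcomp (j : Fin n) : ((Vdata n L).B →₀ ℤ) →ₗ[ℤ] ((L j).B →₀ ℤ) :=
  lcomapDomain (Vsusp L j) (Vsusp_injective L j)

theorem Vcomp_apply (j : Fin n) (y : (Vdata n L).B →₀ ℤ) (a : (L j).B) :
    Vcomp L j y a = y (Vsusp L j a) := rfl

variable {L}

theorem Vdata_ext {y z : (Vdata n L).B →₀ ℤ} (hp : ∀ k, y (Vpoint L k) = z (Vpoint L k))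
    (hs : ∀ j, Vcomp L j y = Vcomp L j z) : y = z := by
  refine Finsupp.ext fun x => ?_
  rcases x with k | ⟨j, a⟩
  · exact hp k
  · exact DFunLike.congr_fun (hs j) a

theorem Vdata_induction {p : (Vdata n L).B → Prop} (hp : ∀ k, p (Vpoint L k))
    (hs : ∀ j a, p (Vsusp L j a)) (x : (Vdata n L).B) : p x := by
  rcases x with k | ⟨j, a⟩
  · exact hp k
  · exact hs j a

variable (L)

@[simp] theorem Vdata_dim_point (k : Fin (n + 1)) : (Vdata n L).dim (Vpoint L k) = 0 := rfl

@[simp] theorem Vdata_dim_susp (j : Fin n) (a : (L j).B) :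
    (Vdata n L).dim (Vsusp L j a) = (L j).dim a + 1 := rfl

@[simp] theorem Vdata_eps_point (k : Fin (n + 1)) : (Vdata n L).eps (Vpoint L k) = 1 := rfl

@[simp] theorem Vdata_d_point (k : Fin (n + 1)) : (Vdata n L).d (Vpoint L k) = 0 := rfl

theorem Vdata_d_susp_of_pos {j : Fin n} {a : (L j).B} (h : 0 < (L j).dim a) :
    (Vdata n L).d (Vsusp L j a) = mapDomain (Vsusp L j) ((L j).d a) :=
  if_pos h

theorem Vdata_d_susp_of_eq_zero {j : Fin n} {a : (L j).B} (h : (L j).dim a = 0) :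
    (Vdata n L).d (Vsusp L j a) =
      (L j).eps a • (single (Vpoint L j.succ) 1 - single (Vpoint L j.castSucc) 1) :=
  if_neg (by omega)

theorem Vpoint_ne_Vsusp (k : Fin (n + 1)) (j : Fin n) (a : (L j).B) :
    Vpoint L k ≠ Vsusp L j a := Sum.inl_ne_inr

theorem Vpoint_injective : Function.Injective (Vpoint L) := Sum.inl_injective

@[simp] theorem single_Vpoint_apply_point (k l : Fin (n + 1)) (c : ℤ) :
    single (Vpoint L k) c (Vpoint L l) = if k = l then c else 0 := by
  classical
  rw [single_apply]
  simp [(Vpoint_injective L).eq_iff]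

@[simp] theorem single_Vsusp_apply_point (j : Fin n) (a : (L j).B) (l : Fin (n + 1)) (c : ℤ) :
    single (Vsusp L j a) c (Vpoint L l) = 0 :=
  single_eq_of_ne (Vpoint_ne_Vsusp L l j a)

@[simp] theorem mapDomain_Vsusp_apply_point (j : Fin n) (x : (L j).B →₀ ℤ) (l : Fin (n + 1)) :
    mapDomain (Vsusp L j) x (Vpoint L l) = 0 :=
  mapDomain_of_notMem_range _ _ fun ⟨a, ha⟩ => Vpoint_ne_Vsusp L l j a ha.symm

@[simp] theorem Vcomp_single_point (j : Fin n) (k : Fin (n + 1)) (c : ℤ) :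
    Vcomp L j (single (Vpoint L k) c) = 0 := by
  ext a
  exact single_eq_of_ne (Vpoint_ne_Vsusp L k j a).symm

theorem Vcomp_mapDomain_self (j : Fin n) (x : (L j).B →₀ ℤ) :
    Vcomp L j (mapDomain (Vsusp L j) x) = x := by
  ext a
  exact mapDomain_apply (Vsusp_injective L j) x a

@[simp] theorem Vcomp_single_susp_self (j : Fin n) (a : (L j).B) (c : ℤ) :
    Vcomp L j (single (Vsusp L j a) c) = single a c := by
  rw [← mapDomain_single, Vcomp_mapDomain_self]

theorem Vcomp_mapDomain_of_ne {i j : Fin n} (h : i ≠ j) (x : (L i).B →₀ ℤ) :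
    Vcomp L j (mapDomain (Vsusp L i) x) = 0 := by
  ext a
  refine mapDomain_of_notMem_range _ _ ?_
  rintro ⟨b, hb⟩
  exact h (congrArg Sigma.fst (Sum.inr_injective hb))

theorem Vcomp_single_susp_of_ne {i j : Fin n} (h : i ≠ j) (a : (L i).B) (c : ℤ) :
    Vcomp L j (single (Vsusp L i a) c) = 0 := by
  rw [← mapDomain_single, Vcomp_mapDomain_of_ne L h]

variable {L}

theorem Vcomp_bnd (hL : ∀ j, (L j).IsADC) (j : Fin n) (y : (Vdata n L).B →₀ ℤ) :
    Vcomp L j ((Vdata n L).bnd y) = (L j).bnd (Vcomp L j y) := by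
  suffices h : (Vcomp L j).comp (linearCombination ℤ (Vdata n L).d) =
      (linearCombination ℤ (L j).d).comp (Vcomp L j) from LinearMap.congr_fun h y
  refine Finsupp.lhom_ext' fun x => LinearMap.ext_ring ?_
  induction x using Vdata_induction with
  | hp k => simp
  | hs i a =>
    suffices h : Vcomp L j ((Vdata n L).d (Vsusp L i a)) =
        linearCombination ℤ (L j).d (Vcomp L j (single (Vsusp L i a) 1)) by
      simpa using h
    rcases Nat.eq_zero_or_pos ((L i).dim a) with h0 | h0
    · rw [Vdata_d_susp_of_eq_zero L h0]
      rcases eq_or_ne i j with rfl | hij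
      · simp [(hL i).1 a h0]
      · simp [Vcomp_single_susp_of_ne L hij]
    · rw [Vdata_d_susp_of_pos L h0]
      rcases eq_or_ne i j with rfl | hij
      · simp [Vcomp_mapDomain_self]
      · simp [Vcomp_mapDomain_of_ne L hij, Vcomp_single_susp_of_ne L hij]

theorem Vdata_bnd_apply_point (y : (Vdata n L).B →₀ ℤ) (k : Fin (n + 1)) :
    (Vdata n L).bnd y (Vpoint L k) = ∑ j, (L j).aug (Vcomp L j y) *
      ((if j.succ = k then 1 else 0) - (if j.castSucc = k then 1 else 0)) := by
  simp only [PreADC.aug_eq_linearCombination, PreADC.bnd_eq_linearCombination]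
  induction y using Finsupp.induction_linear with
  | zero => simp
  | add y z hy hz => simp only [map_add, Finsupp.add_apply, hy, hz, add_mul, Finset.sum_add_distrib]
  | single x c =>
    induction x using Vdata_induction with
    | hp l => simp
    | hs i a =>
      rw [Finset.sum_eq_single i]
      · rw [Vcomp_single_susp_self]
        rcases Nat.eq_zero_or_pos ((L i).dim a) with h0 | h0
        · simp [Vdata_d_susp_of_eq_zero L h0, h0, mul_assoc]
        · simp [Vdata_d_susp_of_pos L h0, h0.ne']
      · intro j _ hj
        simp [Vcomp_single_susp_of_ne L hj.symm]
      · simp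

theorem Vdata_aug (y : (Vdata n L).B →₀ ℤ) :
    (Vdata n L).aug y = ∑ k, y (Vpoint L k) := by
  rw [PreADC.aug_eq_linearCombination]
  induction y using Finsupp.induction_linear with
  | zero => simp
  | add y z hy hz => simp only [map_add, Finsupp.add_apply, hy, hz, Finset.sum_add_distrib]
  | single x c =>
    induction x using Vdata_induction with
    | hp l => simp
    | hs i a => simp

end Vdata

section Vmor

variable {m n : ℕ} {K : Fin m → PreADC} {L : Fin n → PreADC}
  {φ : Fin (m + 1) → Fin (n + 1)} {f : ∀ (i : Fin m) (j : Fin n), (K i).B → ((L j).B →₀ ℤ)}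

theorem Vmor_point (i : Fin (m + 1)) :
    Vmor m n K L φ f (Vpoint K i) = single (Vpoint L (φ i)) 1 := rfl

theorem Vmor_susp (i : Fin m) (b : (K i).B) :
    Vmor m n K L φ f (Vsusp K i b) =
      ∑ j, if InRange φ i j then mapDomain (Vsusp L j) (f i j b) else 0 := rfl

theorem Vmor_susp_apply_point (i : Fin m) (b : (K i).B) (k : Fin (n + 1)) :
    Vmor m n K L φ f (Vsusp K i b) (Vpoint L k) = 0 := by
  rw [Vmor_susp, finsetSum_apply]
  refine Finset.sum_eq_zero fun j _ => ?_
  split_ifs <;> simp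

theorem Vcomp_Vmor_susp (hf : ∀ i j, ¬ InRange φ i j → f i j = fun _ => 0)
    (i : Fin m) (j : Fin n) (b : (K i).B) :
    Vcomp L j (Vmor m n K L φ f (Vsusp K i b)) = f i j b := by
  rw [Vmor_susp, map_sum, Finset.sum_eq_single j]
  · split_ifs with h
    · exact Vcomp_mapDomain_self L j _
    · simp [hf i j h]
  · intro k _ hk
    split_ifs
    · exact Vcomp_mapDomain_of_ne L hk _
    · exact map_zero _
  · simp

theorem inRange_ite_eq (hφ : Monotone φ) (i : Fin m) (j : Fin n) :
    (if InRange φ i j then (1 : ℤ) else 0) =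
      (if j.succ ≤ φ i.succ then 1 else 0) - (if j.succ ≤ φ i.castSucc then 1 else 0) := by
  have h : φ i.castSucc ≤ φ i.succ := hφ (Fin.castSucc_le_succ i)
  simp only [InRange, Fin.le_def, Fin.val_succ, Fin.val_castSucc] at h ⊢
  split_ifs <;> omega

theorem isAugMor_Vmor (hKu : ∀ i, (K i).Unital) (hL : ∀ j, (L j).IsADC)
    (w : WreathMor m n K L) :
    PreADC.IsAugMor (Vdata m K) (Vdata n L) (Vmor m n K L w.φ w.f) := by
  obtain ⟨φ, hφ, f, hf0, hf⟩ := w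
  have hmor : ∀ i j, PreADC.IsMor (K i) (L j) (f i j) := by
    intro i j
    by_cases h : InRange φ i j
    · exact (hf i j h).1
    · rw [hf0 i j h]
      exact ⟨fun b a h => (h rfl).elim, by simp [PreADC.bnd_zero], fun b a => le_rfl⟩
  have hcomp := Vcomp_Vmor_susp (K := K) (L := L) hf0
  refine ⟨⟨fun x y hxy => ?_, fun x => ?_, fun x y => ?_⟩, fun x hx => ?_⟩
  · induction x using Vdata_induction with
    | hp i =>
      induction y using Vdata_induction with
      | hp k => rfl
      | hs j a =>
        rw [Vmor_point] at hxy
        exact (hxy (single_eq_of_ne (Vpoint_ne_Vsusp L _ j a).symm)).elim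
    | hs i b =>
      induction y using Vdata_induction with
      | hp k => exact (hxy (Vmor_susp_apply_point i b k)).elim
      | hs j a =>
        rw [← Vcomp_apply] at hxy
        dsimp only at hxy
        rw [hcomp] at hxy
        simpa using (hmor i j).1 b a hxy
  · induction x using Vdata_induction with
    | hp i =>
      rw [Vmor_point, PreADC.bnd_single]
      simp
    | hs i b =>
      rw [← linearCombination_apply]
      dsimp only
      rcases Nat.eq_zero_or_pos ((K i).dim b) with h0 | h0
      · rw [Vdata_d_susp_of_eq_zero K h0, (hKu i).eps_eq_one h0]
        refine Vdata_ext (fun k => ?_) fun j => ?_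
        · rw [Vdata_bnd_apply_point]
          simp only [hcomp]
          rw [(Fin.sum_mul_succ_sub_castSucc_iff _ (φ i.castSucc) (φ i.succ)).2]
          · simp [Vmor_point]
          · intro j
            rw [← inRange_ite_eq hφ]
            split_ifs with h
            · rw [(hf i j h).2 b h0, (hKu i).eps_eq_one h0]
            · rw [hf0 i j h, PreADC.aug_zero]
        · rw [Vcomp_bnd hL, hcomp, PreADC.bnd_eq_zero_of_dim_eq_zero (hL j)
            fun a ha => ((hmor i j).1 b a ha).trans h0]
          simp [Vmor_point]
      · rw [Vdata_d_susp_of_pos K h0, linearCombination_mapDomain]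
        refine Vdata_ext (fun k => ?_) fun j => ?_
        · rw [Vdata_bnd_apply_point, linearCombination_apply, Finsupp.sum, finsetSum_apply]
          simp only [hcomp]
          rw [Finset.sum_eq_zero, Finset.sum_eq_zero]
          · intro j _
            rw [PreADC.aug_eq_zero_of_dim_ne_zero, zero_mul]
            intro a ha
            rw [(hmor i j).1 b a ha]
            exact h0.ne'
          · intro a _
            simp [Vmor_susp_apply_point]
        · rw [Vcomp_bnd hL, hcomp, ← (hmor i j).2.1 b, linearCombination_apply, Finsupp.sum,
            map_sum]
          exact Finset.sum_congr rfl fun a _ => by simp [hcomp]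
  · induction x using Vdata_induction with
    | hp i =>
      rw [Vmor_point]
      classical
      rw [single_apply]
      split_ifs <;> simp
    | hs i b =>
      induction y using Vdata_induction with
      | hp k => exact (Vmor_susp_apply_point i b k).ge
      | hs j a =>
        rw [← Vcomp_apply]
        dsimp only
        rw [hcomp]
        exact (hmor i j).2.2 b a
  · induction x using Vdata_induction with
    | hp i => simp [Vdata_aug, Vmor_point]
    | hs i b => simp at hx

theorem injective_Vmor :
    Function.Injective fun w : WreathMor m n K L => Vmor m n K L w.φ w.f := by
  rintro ⟨φ, hφ, f, hf0, hf⟩ ⟨ψ, hψ, g, hg0, hg⟩ h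
  dsimp only at h
  obtain rfl : φ = ψ := by
    funext i
    have hi := congrFun h (Vpoint K i)
    rw [Vmor_point, Vmor_point] at hi
    exact Vpoint_injective L (single_left_injective one_ne_zero hi)
  obtain rfl : f = g := by
    funext i j b
    rw [← Vcomp_Vmor_susp hf0, h, Vcomp_Vmor_susp hg0]
  rfl

theorem exists_Vmor_eq (hK : ∀ i, (K i).IsADC) (hKne : ∀ i, Nonempty (K i).B)
    (hKu : ∀ i, (K i).Unital) (hL : ∀ j, (L j).IsADC) (hLu : ∀ j, (L j).Unital)
    (hLl : ∀ j, (L j).LoopFree) {F : (Vdata m K).B → ((Vdata n L).B →₀ ℤ)}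
    (hF : PreADC.IsAugMor (Vdata m K) (Vdata n L) F) :
    ∃ w : WreathMor m n K L, Vmor m n K L w.φ w.f = F := by
  obtain ⟨⟨hdim, hbnd, hnonneg⟩, haug⟩ := hF
  have hpoint : ∀ i, ∃ k, F (Vpoint K i) = single (Vpoint L k) 1 := by
    intro i
    have h1 := haug (Vpoint K i) rfl
    rw [Vdata_aug, Vdata_eps_point] at h1
    obtain ⟨k, hk⟩ := Finset.exists_eq_ite_of_sum_eq_one (fun l => hnonneg _ _) h1
    refine ⟨k, Vdata_ext (fun l => by simp [hk]) fun j => ?_⟩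
    rw [Vcomp_single_point]
    ext a
    by_contra ha
    exact absurd (hdim _ _ ha) (by simp)
  choose φ hφ using hpoint
  have hsusp_point : ∀ i b k, F (Vsusp K i b) (Vpoint L k) = 0 := by
    intro i b k
    by_contra h
    exact absurd (hdim _ _ h) (by simp)
  let f : ∀ (i : Fin m) (j : Fin n), (K i).B → ((L j).B →₀ ℤ) :=
    fun i j b => Vcomp L j (F (Vsusp K i b))
  have hfdim : ∀ i j b a, f i j b a ≠ 0 → (L j).dim a = (K i).dim b := fun i j b a h => by
    simpa using hdim _ _ h
  have hfnonneg : ∀ i j b a, 0 ≤ f i j b a := fun i j b a => hnonneg _ _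
  have hmor : ∀ i j, PreADC.IsMor (K i) (L j) (f i j) := by
    refine fun i j => ⟨hfdim i j, fun b => ?_, hfnonneg i j⟩
    rcases Nat.eq_zero_or_pos ((K i).dim b) with h0 | h0
    · rw [(hK i).1 b h0, PreADC.bnd_eq_zero_of_dim_eq_zero (hL j)
        fun a ha => (hfdim i j b a ha).trans h0]
      simp
    · have h := congrArg (Vcomp L j) (hbnd (Vsusp K i b))
      rw [Vcomp_bnd hL, ← linearCombination_apply, Vdata_d_susp_of_pos K h0,
        linearCombination_mapDomain, linearCombination_apply, Finsupp.sum, map_sum] at h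
      rw [← h]
      exact Finset.sum_congr rfl fun a _ => by simp [f]
  have hfaug : ∀ i j b, (K i).dim b = 0 → (L j).aug (f i j b) =
      (if j.succ ≤ φ i.succ then 1 else 0) - (if j.succ ≤ φ i.castSucc then 1 else 0) := by
    intro i j b h0
    refine (Fin.sum_mul_succ_sub_castSucc_iff (fun j => (L j).aug (f i j b)) _ _).1 (fun k => ?_) j
    rw [← Vdata_bnd_apply_point, ← hbnd, ← linearCombination_apply,
      Vdata_d_susp_of_eq_zero K h0, (hKu i).eps_eq_one h0]
    simp [hφ]
  have hmono : Monotone φ := by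
    refine Fin.monotone_iff_le_succ.2 fun i => ?_
    have := hKne i
    obtain ⟨b, hb⟩ := (hKu i).exists_dim_eq_zero
    by_contra! hlt
    obtain ⟨j, hj⟩ := Fin.exists_succ_eq_of_ne_zero (Fin.ne_zero_of_lt hlt)
    have h1 := hfaug i j b hb
    have h2 := (hLu j).aug_nonneg (hfnonneg i j b)
    rw [hj, if_neg hlt.not_ge, if_pos le_rfl] at h1
    omega
  have hf0 : ∀ i j, ¬ InRange φ i j → f i j = fun _ => 0 := by
    refine fun i j h => funext fun b => (hmor i j).eq_zero (hK i) (hLl j) (hLu j) (fun b hb => ?_) b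
    refine (hLu j).eq_zero_of_aug_eq_zero_s17 (hfnonneg i j b)
      (fun a ha => (hfdim i j b a ha).trans hb) ?_
    rw [hfaug i j b hb, ← inRange_ite_eq hmono, if_neg h]
  refine ⟨⟨φ, hmono, f, hf0, fun i j h => ⟨hmor i j, fun b hb => ?_⟩⟩, funext fun x => ?_⟩
  · rw [hfaug i j b hb, ← inRange_ite_eq hmono, if_pos h, (hKu i).eps_eq_one hb]
  · induction x using Vdata_induction with
    | hp i => rw [Vmor_point, hφ]
    | hs i b =>
      exact Vdata_ext (fun k => by rw [Vmor_susp_apply_point, hsusp_point])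
        fun j => Vcomp_Vmor_susp hf0 i j b

end Vmor

/-- For non-zero augmented directed complexes `K^i`, `L^j` with loop-free unital
bases, the assignment `(φ, f) ↦ V(φ, f)` is a bijection from the set of
wreath-product morphisms `(m, K) → (n, L)` onto the set of morphisms of augmented
directed complexes `V(m, K) → V(n, L)` (i.e. `V : Δ ≀ Φ → Φ` is fully faithful). -/
theorem stmt17 (m n : ℕ) (K : Fin m → PreADC) (L : Fin n → PreADC)
    (hK : ∀ i, PreADC.IsADC (K i)) (hKne : ∀ i, Nonempty (K i).B)
    (hKu : ∀ i, PreADC.Unital (K i)) (hKl : ∀ i, PreADC.LoopFree (K i))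
    (hL : ∀ j, PreADC.IsADC (L j)) (hLne : ∀ j, Nonempty (L j).B)
    (hLu : ∀ j, PreADC.Unital (L j)) (hLl : ∀ j, PreADC.LoopFree (L j)) :
    Set.BijOn (fun w : WreathMor m n K L => Vmor m n K L w.φ w.f)
      Set.univ {F | PreADC.IsAugMor (Vdata m K) (Vdata n L) F} := by
  exact ⟨fun w _ => isAugMor_Vmor hKu hL w, injective_Vmor.injOn, fun F hF => by
    obtain ⟨w, hw⟩ := exists_Vmor_eq hK hKne hKu hL hLu hLl hF
    exact ⟨w, Set.mem_univ w, hw⟩⟩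
end
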